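/- arXiv:2109.05957 — 13 statements merged into one kernel-verified Lean document; each statement's English description precedes it below -/
import Mathlib

section
/- For every integer j ≥ 1, the quartic polynomial Δ_j(X) = j·X⁴ − (6j+1)·X³ + (10j+3)·X² − (6j+1)·X + j has exactly four complex roots, all of which are real, positive, pairwise distinct (hence simple), and none equal to 1; more precisely, Δ_j has exactly one root in each of the open intervals (0, 1/2), (1/2, 1), (1, 2), (2, 5). -/
open Polynomial

/-- For every integer `j ≥ 1`, the Alexander polynomial
`Δ_j(X) = j·X⁴ − (6j+1)·X³ + (10j+3)·X² − (6j+1)·X + j` has exactly four complex roots,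
all real, positive, pairwise distinct and none equal to `1`; precisely one in each of the
intervals `(0,1/2)`, `(1/2,1)`, `(1,2)`, `(2,5)`. -/
theorem alexander_poly_roots (j : ℤ) (hj : 1 ≤ j) :
    ∃ t₁ t₂ t₃ t₄ : ℝ,
      t₁ ∈ Set.Ioo (0 : ℝ) (1/2) ∧
      t₂ ∈ Set.Ioo (1/2 : ℝ) 1 ∧
      t₃ ∈ Set.Ioo (1 : ℝ) 2 ∧
      t₄ ∈ Set.Ioo (2 : ℝ) 5 ∧
      (C (j : ℂ) * X ^ 4 - C ((6 * j + 1 : ℤ) : ℂ) * X ^ 3 +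
        C ((10 * j + 3 : ℤ) : ℂ) * X ^ 2 - C ((6 * j + 1 : ℤ) : ℂ) * X +
        C (j : ℂ)).roots = {(t₁ : ℂ), (t₂ : ℂ), (t₃ : ℂ), (t₄ : ℂ)} := by
  have hj' : (1 : ℝ) ≤ j := by exact_mod_cast hj
  set f : ℝ → ℝ := fun x =>
    j * x ^ 4 - (6 * j + 1) * x ^ 3 + (10 * j + 3) * x ^ 2 - (6 * j + 1) * x + j with hf
  have hcont : Continuous f := by fun_prop
  obtain ⟨t₁, h₁, e₁⟩ : (0 : ℝ) ∈ f '' Set.Ioo 0 (1 / 2) :=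
    intermediate_value_Ioo' (by norm_num) hcont.continuousOn
      ⟨by simp only [hf]; linarith, by simp only [hf]; linarith⟩
  obtain ⟨t₂, h₂, e₂⟩ : (0 : ℝ) ∈ f '' Set.Ioo (1 / 2) 1 :=
    intermediate_value_Ioo (by norm_num) hcont.continuousOn
      ⟨by simp only [hf]; linarith, by simp only [hf]; linarith⟩
  obtain ⟨t₃, h₃, e₃⟩ : (0 : ℝ) ∈ f '' Set.Ioo 1 2 :=
    intermediate_value_Ioo' (by norm_num) hcont.continuousOn
      ⟨by simp only [hf]; linarith, by simp only [hf]; linarith⟩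
  obtain ⟨t₄, h₄, e₄⟩ : (0 : ℝ) ∈ f '' Set.Ioo 2 5 :=
    intermediate_value_Ioo (by norm_num) hcont.continuousOn
      ⟨by simp only [hf]; linarith, by simp only [hf]; linarith⟩
  refine ⟨t₁, t₂, t₃, t₄, h₁, h₂, h₃, h₄, ?_⟩
  set p : ℂ[X] := C (j : ℂ) * X ^ 4 - C ((6 * j + 1 : ℤ) : ℂ) * X ^ 3 +
        C ((10 * j + 3 : ℤ) : ℂ) * X ^ 2 - C ((6 * j + 1 : ℤ) : ℂ) * X + C (j : ℂ) with hp
  have hdeg : p.natDegree = 4 := by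
    rw [hp]
    compute_degree!
    lia
  have hp0 : p ≠ 0 := ne_zero_of_natDegree_gt (n := 0) (by lia)
  have hroot (t : ℝ) (ht : f t = 0) : (t : ℂ) ∈ p.roots := by
    rw [mem_roots hp0, IsRoot.def]
    have heval : p.eval (t : ℂ) = ((f t : ℝ) : ℂ) := by
      simp [hp, hf]
    rw [heval, ht, Complex.ofReal_zero]
  have hnodup : ({(t₁ : ℂ), (t₂ : ℂ), (t₃ : ℂ), (t₄ : ℂ)} : Multiset ℂ).Nodup := by
    have h12 : t₁ < t₂ := h₁.2.trans h₂.1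
    have h23 : t₂ < t₃ := h₂.2.trans h₃.1
    have h34 : t₃ < t₄ := h₃.2.trans h₄.1
    simp [h12.ne, h23.ne, h34.ne, (h12.trans h23).ne, (h23.trans h34).ne,
      (h12.trans (h23.trans h34)).ne]
  symm
  refine Multiset.eq_of_le_of_card_le ((Multiset.le_iff_subset hnodup).2 ?_) ?_
  · intro z hz
    simp only [Multiset.insert_eq_cons, Multiset.mem_cons, Multiset.mem_singleton] at hz
    rcases hz with rfl | rfl | rfl | rfl
    exacts [hroot _ e₁, hroot _ e₂, hroot _ e₃, hroot _ e₄]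
  · simpa [hdeg] using p.card_roots'
end

section
/- For every integer j ≥ 1, setting e_i = (−1)^(⌊ i(14j+3)/(24j+5) ⌋) for 1 ≤ i ≤ 24j+4, the following identity holds in the free group on x, y: y^{e_1} x^{e_2} y^{e_3} x^{e_4} ⋯ y^{e_{24j+3}} x^{e_{24j+4}} = (y x⁻¹ y⁻¹ x) · uʲ, where the left-hand side is the product over k = 1, …, 12j+2 of y^{e_{2k−1}} x^{e_{2k}}. -/
namespace Stmt1

/-- The generator `x` of the free group on two letters. -/
def x : FreeGroup Bool := FreeGroup.of false

/-- The generator `y` of the free group on two letters. -/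
def y : FreeGroup Bool := FreeGroup.of true

/-- The word `u` from the paper. -/
def u : FreeGroup Bool :=
  (y * x⁻¹ * y * x) * (y⁻¹ * x⁻¹ * y * x⁻¹) * (y⁻¹ * x * y * x⁻¹) *
  (y⁻¹ * x * y⁻¹ * x⁻¹) * (y * x * y⁻¹ * x) * (y * x⁻¹ * y⁻¹ * x)

/-- The exponent `e_i = (−1)^⌊ i(14j+3)/(24j+5) ⌋`. -/
noncomputable def e (j : ℕ) (i : ℕ) : ℤ :=
  (((-1 : ℤˣ) ^ ⌊((i : ℝ) * (14 * j + 3)) / (24 * j + 5)⌋ : ℤˣ) : ℤ)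

/-- Shifting the index by `24` adds `14` to the floor and leaves a remainder of `2`, so the sign at
`24 m + s` is read off from a linear inequality. -/
lemma e_eq_neg_one_pow (j m s c : ℕ) (hle : c * (24 * j + 5) ≤ 2 * m + s * (14 * j + 3))
    (hlt : 2 * m + s * (14 * j + 3) < (c + 1) * (24 * j + 5)) :
    e j (24 * m + s) = (-1) ^ c := by
  have hle' : (c : ℝ) * (24 * j + 5) ≤ 2 * m + s * (14 * j + 3) := by exact_mod_cast hle
  have hlt' : 2 * m + s * (14 * j + 3) < ((c : ℝ) + 1) * (24 * j + 5) := by exact_mod_cast hlt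
  have hfloor : ⌊(((24 * m + s : ℕ) : ℝ) * (14 * j + 3)) / (24 * j + 5)⌋
      = ((2 * (7 * m) + c : ℕ) : ℤ) := by
    have hpos : (0 : ℝ) < 24 * j + 5 := by positivity
    rw [Int.floor_eq_iff, le_div_iff₀ hpos, div_lt_iff₀ hpos]
    push_cast
    constructor <;> linarith
  rw [e, hfloor, zpow_natCast, pow_add, pow_mul]
  simp

lemma prod_block (j m : ℕ) (hm : m < j) :
    ((List.range 12).map fun k =>
      y ^ e j (2 * (12 * m + 2 + k) + 1) * x ^ e j (2 * (12 * m + 2 + k) + 2)).prod = u := by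
  have sign (i s c : ℕ) (hi : i = 24 * m + s)
      (hle : c * (24 * j + 5) ≤ 2 * m + s * (14 * j + 3))
      (hlt : 2 * m + s * (14 * j + 3) < (c + 1) * (24 * j + 5)) : e j i = (-1) ^ c :=
    hi ▸ e_eq_neg_one_pow j m s c hle hlt
  simp only [List.range_succ, List.range_zero, List.map_append, List.map_cons, List.map_nil,
    List.prod_append, List.prod_cons, List.prod_nil, List.nil_append, mul_one]
  rw [sign (2 * (12 * m + 2 + 0) + 1) 5 2 (by omega) (by omega) (by omega),
    sign (2 * (12 * m + 2 + 0) + 2) 6 3 (by omega) (by omega) (by omega),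
    sign (2 * (12 * m + 2 + 1) + 1) 7 4 (by omega) (by omega) (by omega),
    sign (2 * (12 * m + 2 + 1) + 2) 8 4 (by omega) (by omega) (by omega),
    sign (2 * (12 * m + 2 + 2) + 1) 9 5 (by omega) (by omega) (by omega),
    sign (2 * (12 * m + 2 + 2) + 2) 10 5 (by omega) (by omega) (by omega),
    sign (2 * (12 * m + 2 + 3) + 1) 11 6 (by omega) (by omega) (by omega),
    sign (2 * (12 * m + 2 + 3) + 2) 12 7 (by omega) (by omega) (by omega),
    sign (2 * (12 * m + 2 + 4) + 1) 13 7 (by omega) (by omega) (by omega),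
    sign (2 * (12 * m + 2 + 4) + 2) 14 8 (by omega) (by omega) (by omega),
    sign (2 * (12 * m + 2 + 5) + 1) 15 8 (by omega) (by omega) (by omega),
    sign (2 * (12 * m + 2 + 5) + 2) 16 9 (by omega) (by omega) (by omega),
    sign (2 * (12 * m + 2 + 6) + 1) 17 9 (by omega) (by omega) (by omega),
    sign (2 * (12 * m + 2 + 6) + 2) 18 10 (by omega) (by omega) (by omega),
    sign (2 * (12 * m + 2 + 7) + 1) 19 11 (by omega) (by omega) (by omega),
    sign (2 * (12 * m + 2 + 7) + 2) 20 11 (by omega) (by omega) (by omega),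
    sign (2 * (12 * m + 2 + 8) + 1) 21 12 (by omega) (by omega) (by omega),
    sign (2 * (12 * m + 2 + 8) + 2) 22 12 (by omega) (by omega) (by omega),
    sign (2 * (12 * m + 2 + 9) + 1) 23 13 (by omega) (by omega) (by omega),
    sign (2 * (12 * m + 2 + 9) + 2) 24 14 (by omega) (by omega) (by omega),
    sign (2 * (12 * m + 2 + 10) + 1) 25 14 (by omega) (by omega) (by omega),
    sign (2 * (12 * m + 2 + 10) + 2) 26 15 (by omega) (by omega) (by omega),
    sign (2 * (12 * m + 2 + 11) + 1) 27 15 (by omega) (by omega) (by omega),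
    sign (2 * (12 * m + 2 + 11) + 2) 28 16 (by omega) (by omega) (by omega)]
  norm_num [u, mul_assoc]

lemma prod_range_two (j : ℕ) :
    ((List.range 2).map fun k => y ^ e j (2 * k + 1) * x ^ e j (2 * k + 2)).prod =
      y * x⁻¹ * y⁻¹ * x := by
  have sign (s c : ℕ) (hle : c * (24 * j + 5) ≤ s * (14 * j + 3))
      (hlt : s * (14 * j + 3) < (c + 1) * (24 * j + 5)) : e j s = (-1) ^ c := by
    simpa using e_eq_neg_one_pow j 0 s c (by simpa using hle) (by simpa using hlt)
  have h₁ := sign 1 0 (by omega) (by omega)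
  have h₂ := sign 2 1 (by omega) (by omega)
  have h₃ := sign 3 1 (by omega) (by omega)
  have h₄ := sign 4 2 (by omega) (by omega)
  simp [List.range_succ, h₁, h₂, h₃, h₄, mul_assoc]

lemma prod_range_eq (j n : ℕ) (hn : n ≤ j) :
    ((List.range (12 * n + 2)).map
        (fun k => y ^ e j (2 * k + 1) * x ^ e j (2 * k + 2))).prod =
      (y * x⁻¹ * y⁻¹ * x) * u ^ n := by
  induction n with
  | zero => simpa using prod_range_two j
  | succ n ih =>
    rw [show 12 * (n + 1) + 2 = 12 * n + 2 + 12 by ring, List.range_add, List.map_append,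
      List.prod_append, ih (by omega), List.map_map, pow_succ, ← mul_assoc]
    exact congrArg _ (prod_block j n hn)

/-- For every integer `j ≥ 1`, in the free group on `x, y` we have
`y^{e₁} x^{e₂} ⋯ y^{e_{24j+3}} x^{e_{24j+4}} = (y x⁻¹ y⁻¹ x) uʲ`. -/
theorem word_w_formula (j : ℕ) (hj : 1 ≤ j) :
    ((List.range (12 * j + 2)).map
        (fun k => y ^ e j (2 * k + 1) * x ^ e j (2 * k + 2))).prod =
      (y * x⁻¹ * y⁻¹ * x) * u ^ j := by
  exact prod_range_eq j j le_rfl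

end Stmt1
end

section
/- For every integer j ≥ 1, setting e_i = (−1)^(⌊ i(14j+3)/(24j+5) ⌋) for 1 ≤ i ≤ 24j+4, the following identity holds in the free group on x, y: x^{e_{24j+4}} y^{e_{24j+3}} ⋯ x^{e_2} y^{e_1} = sʲ · (x y⁻¹ x⁻¹ y), where the left-hand side is the product over k = 1, …, 12j+2 of x^{e_{24j+6−2k}} y^{e_{24j+5−2k}}. -/
namespace Stmt2

/-- The generator `x` of the free group on two letters. -/
def x : FreeGroup Bool := FreeGroup.of false

/-- The generator `y` of the free group on two letters. -/
def y : FreeGroup Bool := FreeGroup.of true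

/-- The word `u` from the paper. -/
def u : FreeGroup Bool :=
  (y * x⁻¹ * y * x) * (y⁻¹ * x⁻¹ * y * x⁻¹) * (y⁻¹ * x * y * x⁻¹) *
  (y⁻¹ * x * y⁻¹ * x⁻¹) * (y * x * y⁻¹ * x) * (y * x⁻¹ * y⁻¹ * x)

/-- The word `s`, which is `u` spelled backwards (the 24 letters of `u` in reverse order). -/
def s : FreeGroup Bool :=
  (x * y⁻¹ * x⁻¹ * y) * (x * y⁻¹ * x * y) * (x⁻¹ * y⁻¹ * x * y⁻¹) *
  (x⁻¹ * y * x * y⁻¹) * (x⁻¹ * y * x⁻¹ * y⁻¹) * (x * y * x⁻¹ * y)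

/-- The exponent `e_i = (−1)^⌊ i(14j+3)/(24j+5) ⌋`. -/
noncomputable def e (j : ℕ) (i : ℕ) : ℤ :=
  (((-1 : ℤˣ) ^ ⌊((i : ℝ) * (14 * j + 3)) / (24 * j + 5)⌋ : ℤˣ) : ℤ)

/-- The sign `(-1)^⌊7i/12⌋`, which agrees with `e j i` in the range `i ≤ 24j+4`. -/
def sign (i : ℕ) : ℤ := (-1) ^ (7 * i / 12)

theorem floor_eq_div (j i : ℕ) (hi : i ≤ 24 * j + 4) :
    ⌊((i : ℝ) * (14 * j + 3)) / (24 * j + 5)⌋ = ((7 * i / 12 : ℕ) : ℤ) := by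
  have hcast : ((i : ℝ) * (14 * j + 3)) / (24 * j + 5)
      = ((i * (14 * j + 3) : ℕ) : ℝ) / ((24 * j + 5 : ℕ) : ℝ) := by
    push_cast; rfl
  rw [hcast, ← Int.natCast_floor_eq_floor (by positivity), Nat.floor_div_eq_div]
  congr 1
  have hlow : 12 * (7 * i / 12) ≤ 7 * i := Nat.mul_div_le _ _
  have hhigh : 7 * i + 1 ≤ 12 * (7 * i / 12 + 1) := by omega
  generalize 7 * i / 12 = q at hlow hhigh
  rw [Nat.div_eq_iff (by omega)]
  constructor
  · nlinarith
  · have h : i * (14 * j + 3) < (q + 1) * (24 * j + 5) := by nlinarith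
    have h' : (q + 1) * (24 * j + 5) = q * (24 * j + 5) + (24 * j + 5) := by ring
    omega

theorem e_eq_sign (j i : ℕ) (hi : i ≤ 24 * j + 4) : e j i = sign i := by
  rw [e, floor_eq_div j i hi, sign, zpow_natCast]
  simp

theorem sign_add_period (j i : ℕ) : sign (24 * j + i) = sign i := by
  have h : 7 * (24 * j + i) / 12 = 2 * (7 * j) + 7 * i / 12 := by omega
  rw [sign, sign, h, pow_add, pow_mul]
  simp

theorem prod_sign (j : ℕ) :
    ((List.range (12 * j + 2)).map
        (fun k => x ^ sign (24 * j + 4 - 2 * k) * y ^ sign (24 * j + 3 - 2 * k))).prod =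
      s ^ j * (x * y⁻¹ * x⁻¹ * y) := by
  induction j with
  | zero => simp [List.range_succ, sign, mul_assoc]
  | succ j ih =>
    rw [show 12 * (j + 1) + 2 = 12 + (12 * j + 2) by ring, List.range_add, List.map_append,
      List.prod_append, List.map_map, pow_succ', mul_assoc s, ← ih]
    congr 1
    · have h : ∀ k ∈ List.range 12,
          x ^ sign (24 * (j + 1) + 4 - 2 * k) * y ^ sign (24 * (j + 1) + 3 - 2 * k) =
            x ^ sign (28 - 2 * k) * y ^ sign (27 - 2 * k) := by
        intro k hk
        have hk' : k < 12 := List.mem_range.mp hk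
        rw [← sign_add_period j (28 - 2 * k), ← sign_add_period j (27 - 2 * k)]
        congr 3 <;> omega
      rw [List.map_congr_left h]
      simp [List.range_succ, sign, s, mul_assoc, pow_succ]
    · congr 1
      refine List.map_congr_left fun k _ => ?_
      simp only [Function.comp_apply]
      congr 3 <;> omega

/-- For every integer `j ≥ 1`, in the free group on `x, y` we have
`x^{e_{24j+4}} y^{e_{24j+3}} ⋯ x^{e₂} y^{e₁} = sʲ (x y⁻¹ x⁻¹ y)`. -/
theorem word_v_formula (j : ℕ) (hj : 1 ≤ j) :
    ((List.range (12 * j + 2)).map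
        (fun k => x ^ e j (24 * j + 4 - 2 * k) * y ^ e j (24 * j + 3 - 2 * k))).prod =
      s ^ j * (x * y⁻¹ * x⁻¹ * y) := by
  rw [← prod_sign j]
  congr 1
  refine List.map_congr_left fun k _ => ?_
  rw [e_eq_sign j _ (by omega), e_eq_sign j _ (by omega)]

end Stmt2
end

section
/- Let m ≥ 1 be an integer and set ε_m = max{1, 24(m−1)+5}. Then for all integers j ≥ m and all integers i with ε_m ≤ i ≤ 24m+4, one has ⌊ i(14j+3)/(24j+5) ⌋ = ⌊ 7i/12 ⌋. -/
/-- Let `m ≥ 1` and `ε_m = max{1, 24(m−1)+5}`. For all integers `j ≥ m` and all integers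
`i` with `ε_m ≤ i ≤ 24m+4`, one has `⌊ i(14j+3)/(24j+5) ⌋ = ⌊ 7i/12 ⌋`. -/
theorem floor_eq_in_range (m : ℤ) (hm : 1 ≤ m) (j : ℤ) (hj : m ≤ j) (i : ℤ)
    (hi₁ : max 1 (24 * (m - 1) + 5) ≤ i) (hi₂ : i ≤ 24 * m + 4) :
    ⌊((i : ℝ) * (14 * (j : ℝ) + 3)) / (24 * (j : ℝ) + 5)⌋ = ⌊(7 * (i : ℝ)) / 12⌋ := by
  have hi : 1 ≤ i := le_trans (le_max_left _ _) hi₁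
  have hd : (0 : ℝ) < 24 * (j : ℝ) + 5 := by
    have : (1 : ℝ) ≤ j := by exact_mod_cast hm.trans hj
    linarith
  obtain ⟨q, hq₁, hq₂⟩ : ∃ q : ℤ, 12 * q ≤ 7 * i ∧ 7 * i + 1 ≤ 12 * (q + 1) :=
    ⟨7 * i / 12, by omega, by omega⟩
  have hq₁' : 12 * (q : ℝ) ≤ 7 * i := by exact_mod_cast hq₁
  have hq₂' : 7 * (i : ℝ) + 1 ≤ 12 * (q + 1) := by exact_mod_cast hq₂
  have hi₀ : (0 : ℝ) < i := by exact_mod_cast hi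
  have hij : (i : ℝ) < 24 * j + 5 := by
    have : i < 24 * j + 5 := by omega
    exact_mod_cast this
  -- The two quotients differ by `i / (12 (24 j + 5))`, which lies strictly between `0` and `1/12`.
  have key : (i : ℝ) * (14 * j + 3) / (24 * j + 5) = (7 * i + i / (24 * j + 5)) / 12 := by
    have hcancel : (i : ℝ) / (24 * j + 5) * (24 * j + 5) = i := div_mul_cancel₀ _ hd.ne'
    rw [div_eq_iff hd.ne']
    linear_combination -hcancel / 12
  have h₀ : 0 < (i : ℝ) / (24 * j + 5) := div_pos hi₀ hd
  have h₁ : (i : ℝ) / (24 * j + 5) < 1 := (div_lt_one hd).2 hij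
  have hl : ⌊(7 * (i : ℝ) + i / (24 * j + 5)) / 12⌋ = q :=
    Int.floor_eq_iff.2 ⟨by linarith, by linarith⟩
  have hr : ⌊7 * (i : ℝ) / 12⌋ = q := Int.floor_eq_iff.2 ⟨by linarith, by linarith⟩
  rw [key, hl, hr]
end

section
/- Let m ≥ 1 be an integer and set ε_m = max{1, 24(m−1)+5}. Then for every integer i with ε_m ≤ i ≤ 24m+4, one has 0 < i(14m+3)/(24m+5) − ⌊ 7i/12 ⌋ ≤ (264m + 55 + i)/(288m + 60) < 1. -/
/-- Let `m ≥ 1` and `ε_m = max{1, 24(m−1)+5}`. For every integer `i` with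
`ε_m ≤ i ≤ 24m+4`, one has
`0 < i(14m+3)/(24m+5) − ⌊7i/12⌋ ≤ (264m+55+i)/(288m+60) < 1`. -/
theorem floor_gap_bound (m : ℤ) (hm : 1 ≤ m) (i : ℤ)
    (hi₁ : max 1 (24 * (m - 1) + 5) ≤ i) (hi₂ : i ≤ 24 * m + 4) :
    0 < (i : ℝ) * (14 * (m : ℝ) + 3) / (24 * (m : ℝ) + 5) - ⌊(7 * (i : ℝ)) / 12⌋ ∧
    (i : ℝ) * (14 * (m : ℝ) + 3) / (24 * (m : ℝ) + 5) - ⌊(7 * (i : ℝ)) / 12⌋ ≤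
      (264 * (m : ℝ) + 55 + i) / (288 * (m : ℝ) + 60) ∧
    (264 * (m : ℝ) + 55 + i) / (288 * (m : ℝ) + 60) < 1 := by
  have hi : 1 ≤ i := (le_max_left _ _).trans hi₁
  have hiR : (1 : ℝ) ≤ i := by exact_mod_cast hi
  have hmR : (1 : ℝ) ≤ m := by exact_mod_cast hm
  have hiR₂ : (i : ℝ) ≤ 24 * m + 4 := by exact_mod_cast hi₂
  have hd : (0 : ℝ) < 24 * m + 5 := by linarith
  have key : (i : ℝ) * (14 * m + 3) / (24 * m + 5) =
      7 * i / 12 + i / (12 * (24 * m + 5)) := by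
    field_simp
    ring
  have bound : (264 * (m : ℝ) + 55 + i) / (288 * m + 60) =
      11 / 12 + i / (12 * (24 * m + 5)) := by
    rw [show (288 * (m : ℝ) + 60) = 12 * (24 * m + 5) by ring]
    field_simp
    ring
  have hpos : (0 : ℝ) < i / (12 * (24 * m + 5)) := by positivity
  have hfloor := Int.floor_le (7 * (i : ℝ) / 12)
  have hfloor' : 7 * (i : ℝ) / 12 - ⌊7 * (i : ℝ) / 12⌋ ≤ 11 / 12 := by
    have hlt := Int.lt_floor_add_one (7 * (i : ℝ) / 12)
    generalize ⌊7 * (i : ℝ) / 12⌋ = k at hlt ⊢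
    have hlt' : 7 * i < 12 * k + 12 := by
      have : 7 * (i : ℝ) < 12 * k + 12 := by linarith
      exact_mod_cast this
    have hle : 7 * (i : ℝ) ≤ 12 * k + 11 := by
      exact_mod_cast (show 7 * i ≤ 12 * k + 11 by omega)
    linarith
  refine ⟨by rw [key]; linarith, by rw [key, bound]; linarith, ?_⟩
  rw [div_lt_one (by linarith)]
  linarith
end

section
/- For all integers j ≥ 1, n ≥ 1, and i with 5 ≤ i ≤ 28 and 5 ≤ i + 24n ≤ 24j + 4, one has ⌊ (i+24n)(14j+3)/(24j+5) ⌋ = ⌊ i(14j+3)/(24j+5) ⌋ + 14n; in particular ⌊ (i+24n)(14j+3)/(24j+5) ⌋ and ⌊ i(14j+3)/(24j+5) ⌋ have the same parity. -/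
/-- Since `12 (14j+3) = 7 (24j+5) + 1`, the slope `(14j+3)/(24j+5)` may be replaced by `7/12`
below `24j+5`. -/
theorem floor_mul_div_eq_seven_mul_ediv_twelve (j m : ℤ) (hm : 0 ≤ m) (hmj : m < 24 * j + 5) :
    ⌊((m : ℝ) * (14 * (j : ℝ) + 3)) / (24 * (j : ℝ) + 5)⌋ = 7 * m / 12 := by
  have hD : 0 < 24 * j + 5 := by lia
  have hD' : (0 : ℝ) < 24 * (j : ℝ) + 5 := by exact_mod_cast hD
  have h₁ : 12 * (7 * m / 12) ≤ 7 * m := by lia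
  have h₂ : 7 * m + 1 ≤ 12 * (7 * m / 12 + 1) := by lia
  generalize 7 * m / 12 = q at h₁ h₂ ⊢
  rw [Int.floor_eq_iff, le_div_iff₀ hD', div_lt_iff₀ hD']
  constructor
  · have : q * (24 * j + 5) ≤ m * (14 * j + 3) := by
      linarith [mul_le_mul_of_nonneg_right h₁ hD.le]
    exact_mod_cast this
  · have : m * (14 * j + 3) < (q + 1) * (24 * j + 5) := by
      linarith [mul_le_mul_of_nonneg_right h₂ hD.le]
    exact_mod_cast this

/-- For all integers `j ≥ 1`, `n ≥ 1` and `i` with `5 ≤ i ≤ 28` and `5 ≤ i+24n ≤ 24j+4`,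
one has `⌊(i+24n)(14j+3)/(24j+5)⌋ = ⌊i(14j+3)/(24j+5)⌋ + 14n`; in particular the two
floors have the same parity. -/
theorem floor_periodicity (j n i : ℤ) (hj : 1 ≤ j) (hn : 1 ≤ n)
    (hi₁ : 5 ≤ i) (hi₂ : i ≤ 28) (hin₁ : 5 ≤ i + 24 * n) (hin₂ : i + 24 * n ≤ 24 * j + 4) :
    ⌊(((i : ℝ) + 24 * n) * (14 * (j : ℝ) + 3)) / (24 * (j : ℝ) + 5)⌋ =
      ⌊((i : ℝ) * (14 * (j : ℝ) + 3)) / (24 * (j : ℝ) + 5)⌋ + 14 * n ∧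
    ⌊(((i : ℝ) + 24 * n) * (14 * (j : ℝ) + 3)) / (24 * (j : ℝ) + 5)⌋ % 2 =
      ⌊((i : ℝ) * (14 * (j : ℝ) + 3)) / (24 * (j : ℝ) + 5)⌋ % 2 := by
  have h₁ := floor_mul_div_eq_seven_mul_ediv_twelve j i (by lia) (by lia)
  have h₂ := floor_mul_div_eq_seven_mul_ediv_twelve j (i + 24 * n) (by lia) (by lia)
  push_cast at h₂
  rw [h₁, h₂]
  constructor <;> lia
end

section
/- In the ring of 2×2 matrices over the Laurent polynomial ring ℤ[τ, τ⁻¹], let A = [[τ, 0], [0, τ⁻¹]] and B = [[τ, 1], [0, τ⁻¹]], with inverses A⁻¹ = [[τ⁻¹, 0], [0, τ]] and B⁻¹ = [[τ⁻¹, −1], [0, τ]]. Then the product U := (B A⁻¹ B A)(B⁻¹ A⁻¹ B A⁻¹)(B⁻¹ A B A⁻¹)(B⁻¹ A B⁻¹ A⁻¹)(B A B⁻¹ A)(B A⁻¹ B⁻¹ A) equals [[1, −(τ³ − 5τ + 5τ⁻¹ − τ⁻³)], [0, 1]]. -/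
namespace Stmt9

open LaurentPolynomial

/-- The matrix `A = [[τ, 0], [0, τ⁻¹]]` over `ℤ[τ, τ⁻¹]`. -/
noncomputable def A : Matrix (Fin 2) (Fin 2) (LaurentPolynomial ℤ) := !![T 1, 0; 0, T (-1)]

/-- The matrix `A⁻¹ = [[τ⁻¹, 0], [0, τ]]` over `ℤ[τ, τ⁻¹]`. -/
noncomputable def A' : Matrix (Fin 2) (Fin 2) (LaurentPolynomial ℤ) := !![T (-1), 0; 0, T 1]

/-- The matrix `B = [[τ, 1], [0, τ⁻¹]]` over `ℤ[τ, τ⁻¹]`. -/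
noncomputable def B : Matrix (Fin 2) (Fin 2) (LaurentPolynomial ℤ) := !![T 1, 1; 0, T (-1)]

/-- The matrix `B⁻¹ = [[τ⁻¹, −1], [0, τ]]` over `ℤ[τ, τ⁻¹]`. -/
noncomputable def B' : Matrix (Fin 2) (Fin 2) (LaurentPolynomial ℤ) := !![T (-1), -1; 0, T 1]

/-- The word `u` evaluated at upper triangular matrices over a commutative ring in which `s` is
the inverse of `t`. -/
theorem word_eq_of_mul_eq_one {R : Type*} [CommRing R] {t s : R} (h : t * s = 1) :
    let a : Matrix (Fin 2) (Fin 2) R := !![t, 0; 0, s]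
    let a' : Matrix (Fin 2) (Fin 2) R := !![s, 0; 0, t]
    let b : Matrix (Fin 2) (Fin 2) R := !![t, 1; 0, s]
    let b' : Matrix (Fin 2) (Fin 2) R := !![s, -1; 0, t]
    (b * a' * b * a) * (b' * a' * b * a') * (b' * a * b * a') *
      (b' * a * b' * a') * (b * a * b' * a) * (b * a' * b' * a) =
      !![1, -(t ^ 3 - 5 * t + 5 * s - s ^ 3); 0, 1] := by
  intro a a' b b'
  simp only [a, a', b, b', Matrix.mul_fin_two]
  congr! 3 <;> grind

/-- The image `U` of the word `u` under `x ↦ A`, `y ↦ B` equals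
`[[1, −(τ³ − 5τ + 5τ⁻¹ − τ⁻³)], [0, 1]]`. -/
theorem U_formula :
    (B * A' * B * A) * (B' * A' * B * A') * (B' * A * B * A') *
      (B' * A * B' * A') * (B * A * B' * A) * (B * A' * B' * A) =
      !![1, -(T 3 - 5 * T 1 + 5 * T (-1) - T (-3)); 0, 1] := by
  have h : (T 1 : LaurentPolynomial ℤ) * T (-1) = 1 := by
    rw [← T_add, add_neg_cancel, T_zero]
  have h₃ : (T 3 : LaurentPolynomial ℤ) = T 1 ^ 3 := by rw [T_pow]; norm_num
  have h₃' : (T (-3) : LaurentPolynomial ℤ) = T (-1) ^ 3 := by rw [T_pow]; norm_num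
  rw [h₃, h₃']
  exact word_eq_of_mul_eq_one h

end Stmt9
end

section
/- In the ring of 2×2 matrices over the Laurent polynomial ring ℤ[τ, τ⁻¹], let A = [[τ, 0], [0, τ⁻¹]], B = [[τ, 1], [0, τ⁻¹]], A⁻¹ = [[τ⁻¹, 0], [0, τ]], B⁻¹ = [[τ⁻¹, −1], [0, τ]], and U = (B A⁻¹ B A)(B⁻¹ A⁻¹ B A⁻¹)(B⁻¹ A B A⁻¹)(B⁻¹ A B⁻¹ A⁻¹)(B A B⁻¹ A)(B A⁻¹ B⁻¹ A). Then for every integer j ≥ 1, (B A⁻¹ B⁻¹ A) · Uʲ = [[1, f_j(τ)], [0, 1]], where f_j(τ) = −jτ³ + (5j+1)τ − (5j+1)τ⁻¹ + jτ⁻³. -/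
namespace Stmt10

open LaurentPolynomial

/-- The matrix `A = [[τ, 0], [0, τ⁻¹]]` over `ℤ[τ, τ⁻¹]`. -/
noncomputable def A : Matrix (Fin 2) (Fin 2) (LaurentPolynomial ℤ) := !![T 1, 0; 0, T (-1)]

/-- The matrix `A⁻¹ = [[τ⁻¹, 0], [0, τ]]` over `ℤ[τ, τ⁻¹]`. -/
noncomputable def A' : Matrix (Fin 2) (Fin 2) (LaurentPolynomial ℤ) := !![T (-1), 0; 0, T 1]

/-- The matrix `B = [[τ, 1], [0, τ⁻¹]]` over `ℤ[τ, τ⁻¹]`. -/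
noncomputable def B : Matrix (Fin 2) (Fin 2) (LaurentPolynomial ℤ) := !![T 1, 1; 0, T (-1)]

/-- The matrix `B⁻¹ = [[τ⁻¹, −1], [0, τ]]` over `ℤ[τ, τ⁻¹]`. -/
noncomputable def B' : Matrix (Fin 2) (Fin 2) (LaurentPolynomial ℤ) := !![T (-1), -1; 0, T 1]

/-- The image `U` of the word `u` under `x ↦ A`, `y ↦ B`. -/
noncomputable def U : Matrix (Fin 2) (Fin 2) (LaurentPolynomial ℤ) :=
  (B * A' * B * A) * (B' * A' * B * A') * (B' * A * B * A') *
    (B' * A * B' * A') * (B * A * B' * A) * (B * A' * B' * A)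

/-- Two `2 × 2` matrices with equal entries are equal. -/
theorem fin_two_congr {R : Type*} {a b c d a' b' c' d' : R}
    (ha : a = a') (hb : b = b') (hc : c = c') (hd : d = d') :
    !![a, b; c, d] = !![a', b'; c', d'] := by
  rw [ha, hb, hc, hd]

/-- `U` is the unipotent matrix with upper-right entry `−τ³ + 5τ − 5τ⁻¹ + τ⁻³`. -/
theorem U_eq : U = !![1, -T 3 + 5 * T 1 - 5 * T (-1) + T (-3); 0, 1] := by
  have hinv : (T 1 * T (-1) : LaurentPolynomial ℤ) = 1 := by rw [← T_add]; simp
  have hpos : (T 3 : LaurentPolynomial ℤ) = T 1 ^ 3 := by rw [T_pow]; norm_num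
  have hneg : (T (-3) : LaurentPolynomial ℤ) = T (-1) ^ 3 := by rw [T_pow]; norm_num
  rw [hpos, hneg]
  simp only [U, A, A', B, B']
  generalize (T 1 : LaurentPolynomial ℤ) = t at *
  generalize (T (-1) : LaurentPolynomial ℤ) = s at *
  simp only [Matrix.mul_fin_two, mul_zero, zero_mul, add_zero, zero_add, mul_one, one_mul]
  apply fin_two_congr <;> grind

/-- For every integer `j ≥ 1`, the image of the word `w = (y x⁻¹ y⁻¹ x) uʲ` under
`x ↦ A`, `y ↦ B` equals `[[1, f_j(τ)], [0, 1]]` with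
`f_j(τ) = −jτ³ + (5j+1)τ − (5j+1)τ⁻¹ + jτ⁻³`. -/
theorem W_formula (j : ℕ) (hj : 1 ≤ j) :
    (B * A' * B' * A) * U ^ j =
      !![1, -(j : LaurentPolynomial ℤ) * T 3 + (5 * (j : LaurentPolynomial ℤ) + 1) * T 1
            - (5 * (j : LaurentPolynomial ℤ) + 1) * T (-1) + (j : LaurentPolynomial ℤ) * T (-3);
          0, 1] := by
  have hinv : (T 1 * T (-1) : LaurentPolynomial ℤ) = 1 := by rw [← T_add]; simp
  have hcomm : B * A' * B' * A = !![1, T 1 - T (-1); 0, 1] := by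
    simp only [A, A', B, B', Matrix.mul_fin_two]
    apply fin_two_congr <;> grind
  clear hj
  induction j with
  | zero => simp [hcomm]
  | succ n ih =>
    rw [pow_succ, ← mul_assoc, ih, U_eq, Matrix.mul_fin_two]
    push_cast
    apply fin_two_congr <;> grind

end Stmt10
end

section
/- Let j ≥ 1 be an integer and let t be a nonzero complex number. There exists a group homomorphism φ : Γ_j → SL₂(ℂ) with φ(x) = [[t, 0], [0, t⁻¹]] and φ(y) = [[t, 1], [0, t⁻¹]] if and only if j·t⁸ − (6j+1)·t⁶ + (10j+3)·t⁴ − (6j+1)·t² + j = 0, i.e. if and only if t² is a root of the Alexander polynomial Δ_j. -/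
namespace Stmt11

/-- The generator `x` of the free group on two letters. -/
def x : FreeGroup Bool := FreeGroup.of false

/-- The generator `y` of the free group on two letters. -/
def y : FreeGroup Bool := FreeGroup.of true

/-- The word `u` from the paper. -/
def u : FreeGroup Bool :=
  (y * x⁻¹ * y * x) * (y⁻¹ * x⁻¹ * y * x⁻¹) * (y⁻¹ * x * y * x⁻¹) *
  (y⁻¹ * x * y⁻¹ * x⁻¹) * (y * x * y⁻¹ * x) * (y * x⁻¹ * y⁻¹ * x)

/-- The word `w = (y x⁻¹ y⁻¹ x) uʲ`. -/
def w (j : ℕ) : FreeGroup Bool := (y * x⁻¹ * y⁻¹ * x) * u ^ j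

/-- The relation `x w = w y` of the knot group `Γ_j = ⟨x, y ∣ x w = w y⟩`. -/
def rels (j : ℕ) : Set (FreeGroup Bool) := {(x * w j) * (w j * y)⁻¹}

/-- The knot group `Γ_j = ⟨x, y ∣ x w = w y⟩` of the two-bridge knot `[1,1,2,2,2j]`. -/
abbrev Γ (j : ℕ) := PresentedGroup (rels j)

/-- The upper triangular matrix `[[t, b], [0, t⁻¹]]` of determinant one. -/
noncomputable def upper (t : ℂˣ) (b : ℂ) : Matrix.SpecialLinearGroup (Fin 2) ℂ :=
  ⟨!![(t : ℂ), b; 0, (t : ℂ)⁻¹], by simp [Matrix.det_fin_two_of]⟩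

theorem coe_upper (t : ℂˣ) (b : ℂ) :
    (upper t b : Matrix (Fin 2) (Fin 2) ℂ) = !![(t : ℂ), b; 0, (t : ℂ)⁻¹] := rfl

theorem upper_mul (s t : ℂˣ) (b d : ℂ) :
    upper s b * upper t d = upper (s * t) (s * d + b * (t : ℂ)⁻¹) := by
  apply Subtype.ext
  simp [coe_upper, mul_comm]

theorem upper_inv (t : ℂˣ) (b : ℂ) : (upper t b)⁻¹ = upper t⁻¹ (-b) := by
  apply Subtype.ext
  rw [Matrix.SpecialLinearGroup.coe_inv]
  simp [coe_upper, Matrix.adjugate_fin_two_of]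

theorem upper_one_pow (b : ℂ) (n : ℕ) : upper 1 b ^ n = upper 1 (n * b) := by
  induction n with
  | zero =>
    apply Subtype.ext
    simp [coe_upper, Matrix.one_fin_two]
  | succ n ih =>
    rw [pow_succ, ih, upper_mul]
    congr 1
    · simp
    · push_cast
      simp
      ring

theorem upper_inj {t : ℂˣ} {b d : ℂ} : upper t b = upper t d ↔ b = d := by
  refine ⟨fun h => ?_, fun h => h ▸ rfl⟩
  simpa [coe_upper] using congrArg (fun A : Matrix.SpecialLinearGroup (Fin 2) ℂ => A 0 1) h

section

variable {t : ℂˣ} {f : FreeGroup Bool →* Matrix.SpecialLinearGroup (Fin 2) ℂ}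

theorem map_commutator (hx : f x = upper t 0) (hy : f y = upper t 1) :
    f (y * x⁻¹ * y⁻¹ * x) = upper 1 ((t : ℂ) - (t : ℂ)⁻¹) := by
  have ht : (t : ℂ) ≠ 0 := t.ne_zero
  simp only [map_mul, map_inv, hx, hy, upper_inv, upper_mul]
  congr 1
  · simp
  · push_cast
    field_simp
    ring

theorem map_u (hx : f x = upper t 0) (hy : f y = upper t 1) :
    f u = upper 1 (-(t : ℂ) ^ 3 + 5 * t - 5 * (t : ℂ)⁻¹ + (t : ℂ)⁻¹ ^ 3) := by
  have ht : (t : ℂ) ≠ 0 := t.ne_zero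
  simp only [u, map_mul, map_inv, hx, hy, upper_inv, upper_mul]
  congr 1
  · apply Units.ext
    push_cast
    field_simp
  · push_cast
    field_simp
    ring

theorem map_relator_eq_one_iff (j : ℕ) (hx : f x = upper t 0) (hy : f y = upper t 1) :
    f (x * w j * (w j * y)⁻¹) = 1 ↔
      (j : ℂ) * t ^ 8 - (6 * (j : ℂ) + 1) * t ^ 6 + (10 * (j : ℂ) + 3) * t ^ 4
        - (6 * (j : ℂ) + 1) * t ^ 2 + (j : ℂ) = 0 := by
  have ht : (t : ℂ) ≠ 0 := t.ne_zero
  rw [map_mul, map_inv, mul_inv_eq_one, map_mul, map_mul, w, map_mul, map_pow,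
    map_commutator hx hy, map_u hx hy, hx, hy, upper_one_pow, upper_mul, upper_mul, upper_mul,
    mul_one, mul_one, one_mul, upper_inj, ← sub_eq_zero, ← mul_right_inj' (pow_ne_zero 4 ht),
    mul_zero, ← neg_eq_zero]
  apply Eq.congr _ rfl
  push_cast
  field_simp
  ring

end

/-- Let `j ≥ 1` and let `t` be a nonzero complex number. There is a homomorphism
`φ : Γ_j → SL₂(ℂ)` with `φ(x) = [[t,0],[0,t⁻¹]]` and `φ(y) = [[t,1],[0,t⁻¹]]` iff
`j t⁸ − (6j+1) t⁶ + (10j+3) t⁴ − (6j+1) t² + j = 0`, i.e. iff `t²` is a root of the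
Alexander polynomial `Δ_j`. -/
theorem exists_nonabelian_reducible_iff (j : ℕ) (hj : 1 ≤ j) (t : ℂ) (ht : t ≠ 0) :
    (∃ φ : Γ j →* Matrix.SpecialLinearGroup (Fin 2) ℂ,
        (φ (PresentedGroup.of false) : Matrix (Fin 2) (Fin 2) ℂ) = !![t, 0; 0, t⁻¹] ∧
        (φ (PresentedGroup.of true) : Matrix (Fin 2) (Fin 2) ℂ) = !![t, 1; 0, t⁻¹]) ↔
      (j : ℂ) * t ^ 8 - (6 * (j : ℂ) + 1) * t ^ 6 + (10 * (j : ℂ) + 3) * t ^ 4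
        - (6 * (j : ℂ) + 1) * t ^ 2 + (j : ℂ) = 0 := by
  lift t to ℂˣ using ht.isUnit
  constructor
  · rintro ⟨φ, hx, hy⟩
    refine (map_relator_eq_one_iff (f := φ.comp (PresentedGroup.mk (rels j))) j
      (Subtype.ext hx) (Subtype.ext hy)).1 ?_
    rw [MonoidHom.comp_apply, PresentedGroup.one_of_mem (rels := rels j) rfl, map_one]
  · intro h
    let g : Bool → Matrix.SpecialLinearGroup (Fin 2) ℂ :=
      fun b => upper t (if b then 1 else 0)
    have hg : ∀ r ∈ rels j, FreeGroup.lift g r = 1 := by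
      rintro r rfl
      exact (map_relator_eq_one_iff j (by simp [x, g]) (by simp [y, g])).2 h
    refine ⟨PresentedGroup.toGroup hg, ?_, ?_⟩ <;>
      simp [PresentedGroup.toGroup.of, g, coe_upper]

end Stmt11
end

section
/- For every integer j ≥ 1, the polynomials Δ_j(X) = jX⁴ − (6j+1)X³ + (10j+3)X² − (6j+1)X + j and h_j(X) = 2jX² − (6j+1)X + 2j have no common root in ℂ. -/
/-- For every integer `j ≥ 1`, the Alexander polynomial
`Δ_j(X) = jX⁴ − (6j+1)X³ + (10j+3)X² − (6j+1)X + j` and the polynomial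
`h_j(X) = 2jX² − (6j+1)X + 2j` have no common root in `ℂ`. -/
theorem no_common_root (j : ℤ) (hj : 1 ≤ j) (z : ℂ)
    (hΔ : (j : ℂ) * z ^ 4 - (6 * (j : ℂ) + 1) * z ^ 3 + (10 * (j : ℂ) + 3) * z ^ 2
      - (6 * (j : ℂ) + 1) * z + (j : ℂ) = 0) :
    2 * (j : ℂ) * z ^ 2 - (6 * (j : ℂ) + 1) * z + 2 * (j : ℂ) ≠ 0 := by
  intro hh
  -- `4jΔ_j = h_j² - (4j² + 1)X²`
  have key : (4 * (j : ℂ) ^ 2 + 1) * z ^ 2 = 0 := by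
    linear_combination (2 * (j : ℂ) * z ^ 2 - (6 * (j : ℂ) + 1) * z + 2 * (j : ℂ)) * hh
      - 4 * (j : ℂ) * hΔ
  rcases mul_eq_zero.mp key with h | h
  · have : 4 * j ^ 2 + 1 = 0 := by exact_mod_cast h
    nlinarith
  · have hz : z = 0 := pow_eq_zero_iff two_ne_zero |>.mp h
    subst hz
    have : j = 0 := by
      have : (j : ℂ) = 0 := by linear_combination hΔ
      exact_mod_cast this
    omega
end

section
/- Let j ≥ 1 be an integer, let t ∈ ℝ with t ∉ {0, 1, −1} and Δ_j(t²) = 0, and let ρ : Γ_j(0) → GL₃(ℂ) be any group homomorphism with ρ(x) = [[t², 0, 0], [0, 1, 0], [0, 0, t⁻²]] and ρ(y) = [[t², −2t, −1], [0, 1, t⁻¹], [0, 0, t⁻²]]. Then every cohomology class in H¹(Γ_j(0); ℂ³_ρ) is represented by a 1-cocycle z : Γ_j(0) → ℂ³ such that z(x) = (0, α, β) and z(y) = (0, α, 0) for some α, β ∈ ℂ. -/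
namespace Stmt14

open Matrix

/-- The generator `x` of the free group on two letters. -/
def x : FreeGroup Bool := FreeGroup.of false

/-- The generator `y` of the free group on two letters. -/
def y : FreeGroup Bool := FreeGroup.of true

/-- The word `u` from the paper. -/
def u : FreeGroup Bool :=
  (y * x⁻¹ * y * x) * (y⁻¹ * x⁻¹ * y * x⁻¹) * (y⁻¹ * x * y * x⁻¹) *
  (y⁻¹ * x * y⁻¹ * x⁻¹) * (y * x * y⁻¹ * x) * (y * x⁻¹ * y⁻¹ * x)

/-- The word `s`, which is `u` spelled backwards (the 24 letters of `u` in reverse order). -/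
def s : FreeGroup Bool :=
  (x * y⁻¹ * x⁻¹ * y) * (x * y⁻¹ * x * y) * (x⁻¹ * y⁻¹ * x * y⁻¹) *
  (x⁻¹ * y * x * y⁻¹) * (x⁻¹ * y * x⁻¹ * y⁻¹) * (x * y * x⁻¹ * y)

/-- The word `w = (y x⁻¹ y⁻¹ x) uʲ`. -/
def w (j : ℕ) : FreeGroup Bool := (y * x⁻¹ * y⁻¹ * x) * u ^ j

/-- The word `v = sʲ (x y⁻¹ x⁻¹ y)`. -/
def v (j : ℕ) : FreeGroup Bool := s ^ j * (x * y⁻¹ * x⁻¹ * y)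

/-- The relations `x w = w y` and `w v = 1` of `Γ_j(0) = ⟨x, y ∣ x w = w y, w v = 1⟩`. -/
def rels (j : ℕ) : Set (FreeGroup Bool) := {(x * w j) * (w j * y)⁻¹, w j * v j}

/-- The group `Γ_j(0) = ⟨x, y ∣ x w = w y, w v = 1⟩` of the `0`-filling. -/
abbrev Γ₀ (j : ℕ) := PresentedGroup (rels j)

/-- `z : Γ_j(0) → ℂ³` is a 1-cocycle for the action given by `ρ` when
`z(gh) = z(g) + ρ(g)·z(h)` for all `g, h`. -/
def IsCocycle {j : ℕ} (ρ : Γ₀ j →* GL (Fin 3) ℂ) (z : Γ₀ j → Fin 3 → ℂ) : Prop :=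
  ∀ g h : Γ₀ j, z (g * h) = z g + (ρ g : Matrix (Fin 3) (Fin 3) ℂ).mulVec (z h)

end Stmt14

namespace Stmt14

open Matrix

/-- The invertible upper triangular matrices of size three with middle diagonal entry `1`. -/
def middleUnitriangular : Subgroup (GL (Fin 3) ℂ) where
  carrier := {M | M.1 1 0 = 0 ∧ M.1 2 0 = 0 ∧ M.1 2 1 = 0 ∧ M.1 1 1 = 1}
  one_mem' := by simp
  mul_mem' := by
    rintro M N ⟨h1, h2, h3, h4⟩ ⟨k1, k2, k3, k4⟩
    simp only [Set.mem_ofPred_eq, Units.val_mul, Matrix.mul_apply, Fin.sum_univ_three]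
    simp [h1, h2, h3, h4, k1, k2, k3, k4]
  inv_mem' := by
    rintro M ⟨h1, h2, h3, h4⟩
    have e (a b : Fin 3) :
        M.1 a 0 * M⁻¹.1 0 b + M.1 a 1 * M⁻¹.1 1 b + M.1 a 2 * M⁻¹.1 2 b =
          (1 : Matrix (Fin 3) (Fin 3) ℂ) a b := by
      rw [← Fin.sum_univ_three (fun c => M.1 a c * M⁻¹.1 c b), ← Matrix.mul_apply,
        ← Units.val_mul, mul_inv_cancel, Units.val_one]
    have e22 := e 2 2
    have e20 := e 2 0
    have e21 := e 2 1
    have e10 := e 1 0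
    have e11 := e 1 1
    simp only [h1, h2, h3, h4, zero_mul, zero_add, one_mul, Matrix.one_apply_eq]
      at e22 e20 e21 e10 e11
    have h : M.1 2 2 ≠ 0 := left_ne_zero_of_mul_eq_one e22
    have k2 : M⁻¹.1 2 0 = 0 := by simpa [h] using e20
    have k3 : M⁻¹.1 2 1 = 0 := by simpa [h] using e21
    rw [k2] at e10
    rw [k3] at e11
    exact ⟨by simpa using e10, k2, k3, by simpa using e11⟩

/-- A homomorphism sending both generators into a subgroup takes all its values there. -/
theorem map_mem_of_generators {G : Type*} [Group G] {j : ℕ} (ρ : Γ₀ j →* G) (H : Subgroup G)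
    (hx : ρ (PresentedGroup.of false) ∈ H) (hy : ρ (PresentedGroup.of true) ∈ H) (g : Γ₀ j) :
    ρ g ∈ H := by
  have h : Subgroup.closure (Set.range (PresentedGroup.of (rels := rels j))) ≤ H.comap ρ := by
    rw [Subgroup.closure_le]
    rintro _ ⟨b, rfl⟩
    cases b
    · exact hx
    · exact hy
  rw [PresentedGroup.closure_range_of] at h
  exact h (Subgroup.mem_top g)

theorem of_mul_w (j : ℕ) :
    (PresentedGroup.of false : Γ₀ j) * PresentedGroup.mk (rels j) (w j) =
      PresentedGroup.mk (rels j) (w j) * PresentedGroup.of true := by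
  have h := PresentedGroup.one_of_mem (rels := rels j) (x := (x * w j) * (w j * y)⁻¹)
    (by simp [rels])
  rw [map_mul, map_inv, mul_inv_eq_one, map_mul, map_mul] at h
  exact h

/-- Subtracting a coboundary from a cocycle gives a cocycle. -/
theorem IsCocycle.sub_coboundary {j : ℕ} {ρ : Γ₀ j →* GL (Fin 3) ℂ} {z : Γ₀ j → Fin 3 → ℂ}
    (hz : IsCocycle ρ z) (v₀ : Fin 3 → ℂ) :
    IsCocycle ρ fun g => z g - ((ρ g : Matrix (Fin 3) (Fin 3) ℂ).mulVec v₀ - v₀) := by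
  intro g h
  simp only [hz g h, map_mul, Units.val_mul, Matrix.mulVec_sub, Matrix.mulVec_mulVec]
  abel

/-- Every cohomology class in `H¹(Γ_j(0); ℂ³_ρ)` is represented by a 1-cocycle `z'` with
`z'(x) = (0, α, β)` and `z'(y) = (0, α, 0)` for some `α, β ∈ ℂ`. -/
theorem cohomology_class_normal_form (j : ℕ) (hj : 1 ≤ j) (t : ℝ)
    (ht0 : t ≠ 0) (ht1 : t ≠ 1) (ht1' : t ≠ -1)
    (hΔ : (j : ℝ) * (t ^ 2) ^ 4 - (6 * (j : ℝ) + 1) * (t ^ 2) ^ 3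
      + (10 * (j : ℝ) + 3) * (t ^ 2) ^ 2 - (6 * (j : ℝ) + 1) * t ^ 2 + (j : ℝ) = 0)
    (ρ : Γ₀ j →* GL (Fin 3) ℂ)
    (hx : (ρ (PresentedGroup.of false) : Matrix (Fin 3) (Fin 3) ℂ) =
      !![(t : ℂ) ^ 2, 0, 0; 0, 1, 0; 0, 0, ((t : ℂ) ^ 2)⁻¹])
    (hy : (ρ (PresentedGroup.of true) : Matrix (Fin 3) (Fin 3) ℂ) =
      !![(t : ℂ) ^ 2, -2 * (t : ℂ), -1; 0, 1, (t : ℂ)⁻¹; 0, 0, ((t : ℂ) ^ 2)⁻¹])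
    (z : Γ₀ j → Fin 3 → ℂ) (hz : IsCocycle ρ z) :
    ∃ (α β : ℂ) (z' : Γ₀ j → Fin 3 → ℂ) (v₀ : Fin 3 → ℂ),
      IsCocycle ρ z' ∧
      z' (PresentedGroup.of false) = ![0, α, β] ∧
      z' (PresentedGroup.of true) = ![0, α, 0] ∧
      ∀ g : Γ₀ j, z g = z' g +
        ((ρ g : Matrix (Fin 3) (Fin 3) ℂ).mulVec v₀ - v₀) := by
  have hT : (t : ℂ) ≠ 0 := by exact_mod_cast ht0
  have hT2 : (t : ℂ) ^ 2 - 1 ≠ 0 := by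
    have h : t ^ 2 - 1 ≠ 0 := by
      simpa [sub_eq_zero] using And.intro ht1 ht1'
    exact_mod_cast h
  have hT3 : ((t : ℂ) ^ 2)⁻¹ - 1 ≠ 0 := by
    intro h
    apply hT2
    rw [sub_eq_zero, inv_eq_one] at h
    rw [h, sub_self]
  set a := z (PresentedGroup.of false) with ha
  set b := z (PresentedGroup.of true) with hb
  obtain ⟨v1, e1⟩ : ∃ v1, v1 * ((t : ℂ) ^ 2 - 1) = a 0 := ⟨_, div_mul_cancel₀ _ hT2⟩
  obtain ⟨v3, e3⟩ : ∃ v3, v3 * (((t : ℂ) ^ 2)⁻¹ - 1) = b 2 := ⟨_, div_mul_cancel₀ _ hT3⟩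
  obtain ⟨v2, e2⟩ : ∃ v2, v2 * (2 * t) = ((t : ℂ) ^ 2 - 1) * v1 - v3 - b 0 :=
    ⟨_, div_mul_cancel₀ _ (mul_ne_zero two_ne_zero hT)⟩
  let z' : Γ₀ j → Fin 3 → ℂ := fun g =>
    z g - ((ρ g : Matrix (Fin 3) (Fin 3) ℂ).mulVec ![v1, v2, v3] - ![v1, v2, v3])
  have hz' : IsCocycle ρ z' := hz.sub_coboundary _
  have hx0 : z' (PresentedGroup.of false) 0 = 0 := by
    simp only [z', hx, ← ha, Pi.sub_apply, Matrix.mulVec, dotProduct, Fin.sum_univ_three]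
    simp only [Matrix.of_apply, Matrix.cons_val]
    linear_combination -e1
  have hy0 : z' (PresentedGroup.of true) 0 = 0 := by
    simp only [z', hy, ← hb, Pi.sub_apply, Matrix.mulVec, dotProduct, Fin.sum_univ_three]
    simp only [Matrix.of_apply, Matrix.cons_val]
    linear_combination e2
  have hy2 : z' (PresentedGroup.of true) 2 = 0 := by
    simp only [z', hy, ← hb, Pi.sub_apply, Matrix.mulVec, dotProduct, Fin.sum_univ_three]
    simp only [Matrix.of_apply, Matrix.cons_val]
    linear_combination -e3
  have hw := map_mem_of_generators ρ middleUnitriangular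
    (by refine ⟨?_, ?_, ?_, ?_⟩ <;> simp [hx]) (by refine ⟨?_, ?_, ?_, ?_⟩ <;> simp [hy])
    (PresentedGroup.mk (rels j) (w j))
  have hxy : z' (PresentedGroup.of true) 1 = z' (PresentedGroup.of false) 1 := by
    have h := congrFun (congrArg z' (of_mul_w j)) 1
    rw [hz', hz', hx] at h
    simp only [Pi.add_apply, Matrix.mulVec, dotProduct, Fin.sum_univ_three, hy0, hy2,
      hw.2.2.2] at h
    simp at h
    linear_combination -h
  refine ⟨z' (PresentedGroup.of false) 1, z' (PresentedGroup.of false) 2, z', ![v1, v2, v3],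
    hz', ?_, ?_, fun g => (sub_add_cancel _ _).symm⟩
  · ext i
    fin_cases i <;> simp [hx0]
  · ext i
    fin_cases i <;> simp [hy0, hy2, hxy]

end Stmt14
end

section
/- Let j ≥ 1 be an integer, let t ∈ ℝ with t ∉ {0, 1, −1} and Δ_j(t²) = 0, let ρ : Γ_j(0) → GL₃(ℂ) be any group homomorphism with ρ(x) = [[t², 0, 0], [0, 1, 0], [0, 0, t⁻²]] and ρ(y) = [[t², −2t, −1], [0, 1, t⁻¹], [0, 0, t⁻²]], and let z : Γ_j(0) → ℂ³ be a 1-cocycle with z(x) = (0, α, β) and z(y) = (0, α, 0). Write f = −jt³ + (5j+1)t − (5j+1)t⁻¹ + jt⁻³, let w̄, v̄ ∈ Γ_j(0) denote the images of the words w and v, and write z(w̄) = (ω₁, ω₂, ω₃) and z(v̄) = (ν₁, ν₂, ν₃). Then: (i) ω₃ = t·f·β and ν₃ = −t·f·β; (ii) ω₂ = ( (1/2)j(j+1)t⁷ − 5j(j+1)t⁵ + (1/2)(35j²+31j+2)t³ − (1/2)(52j²+28j+4)t + (1/2)j(35j−3)t⁻¹ − (1/2)j(10j−6)t⁻³ +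 (1/2)j(j−1)t⁻⁵ )·β; (iii) ν₂ = ( (1/2)j(j+1)t⁷ − 5j(j+1)t⁵ + (1/2)(35j²+27j+2)t³ − (1/2)(52j²+12j)t + (1/2)j(35j−7)t⁻¹ − (1/2)j(10j−6)t⁻³ + (1/2)j(j−1)t⁻⁵ )·β; (iv) there exists h ∈ ℂ with ω₁ = α·(−4jt³ + (10j+2)t − 2jt⁻³) + β·h. -/
namespace Stmt15

open Matrix

/-- The generator `x` of the free group on two letters. -/
def x : FreeGroup Bool := FreeGroup.of false

/-- The generator `y` of the free group on two letters. -/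
def y : FreeGroup Bool := FreeGroup.of true

/-- The word `u` from the paper. -/
def u : FreeGroup Bool :=
  (y * x⁻¹ * y * x) * (y⁻¹ * x⁻¹ * y * x⁻¹) * (y⁻¹ * x * y * x⁻¹) *
  (y⁻¹ * x * y⁻¹ * x⁻¹) * (y * x * y⁻¹ * x) * (y * x⁻¹ * y⁻¹ * x)

/-- The word `s`, which is `u` spelled backwards (the 24 letters of `u` in reverse order). -/
def s : FreeGroup Bool :=
  (x * y⁻¹ * x⁻¹ * y) * (x * y⁻¹ * x * y) * (x⁻¹ * y⁻¹ * x * y⁻¹) *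
  (x⁻¹ * y * x * y⁻¹) * (x⁻¹ * y * x⁻¹ * y⁻¹) * (x * y * x⁻¹ * y)

/-- The word `w = (y x⁻¹ y⁻¹ x) uʲ`. -/
def w (j : ℕ) : FreeGroup Bool := (y * x⁻¹ * y⁻¹ * x) * u ^ j

/-- The word `v = sʲ (x y⁻¹ x⁻¹ y)`. -/
def v (j : ℕ) : FreeGroup Bool := s ^ j * (x * y⁻¹ * x⁻¹ * y)

/-- The relations `x w = w y` and `w v = 1` of `Γ_j(0) = ⟨x, y ∣ x w = w y, w v = 1⟩`. -/
def rels (j : ℕ) : Set (FreeGroup Bool) := {(x * w j) * (w j * y)⁻¹, w j * v j}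

/-- The group `Γ_j(0) = ⟨x, y ∣ x w = w y, w v = 1⟩` of the `0`-filling. -/
abbrev Γ₀ (j : ℕ) := PresentedGroup (rels j)

/-- `z : Γ_j(0) → ℂ³` is a 1-cocycle for the action given by `ρ` when
`z(gh) = z(g) + ρ(g)·z(h)` for all `g, h`. -/
def IsCocycle {j : ℕ} (ρ : Γ₀ j →* GL (Fin 3) ℂ) (z : Γ₀ j → Fin 3 → ℂ) : Prop :=
  ∀ g h : Γ₀ j, z (g * h) = z g + (ρ g : Matrix (Fin 3) (Fin 3) ℂ).mulVec (z h)

end Stmt15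

namespace Stmt15

open Matrix

/-- `f = −jt³ + (5j+1)t − (5j+1)t⁻¹ + jt⁻³`. -/
noncomputable def f (j : ℕ) (t : ℂ) : ℂ :=
  -(j : ℂ) * t ^ 3 + (5 * (j : ℂ) + 1) * t - (5 * (j : ℂ) + 1) * t⁻¹ + (j : ℂ) * (t ^ 3)⁻¹

/-- The coefficient of `β` in `ω₂`. -/
noncomputable def Cw (j : ℕ) (t : ℂ) : ℂ :=
  (1 / 2) * (j : ℂ) * ((j : ℂ) + 1) * t ^ 7 - 5 * (j : ℂ) * ((j : ℂ) + 1) * t ^ 5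
    + (1 / 2) * (35 * (j : ℂ) ^ 2 + 31 * (j : ℂ) + 2) * t ^ 3
    - (1 / 2) * (52 * (j : ℂ) ^ 2 + 28 * (j : ℂ) + 4) * t
    + (1 / 2) * (j : ℂ) * (35 * (j : ℂ) - 3) * t⁻¹
    - (1 / 2) * (j : ℂ) * (10 * (j : ℂ) - 6) * (t ^ 3)⁻¹
    + (1 / 2) * (j : ℂ) * ((j : ℂ) - 1) * (t ^ 5)⁻¹

/-- The coefficient of `β` in `ν₂`. -/
noncomputable def Cv (j : ℕ) (t : ℂ) : ℂ :=
  (1 / 2) * (j : ℂ) * ((j : ℂ) + 1) * t ^ 7 - 5 * (j : ℂ) * ((j : ℂ) + 1) * t ^ 5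
    + (1 / 2) * (35 * (j : ℂ) ^ 2 + 27 * (j : ℂ) + 2) * t ^ 3
    - (1 / 2) * (52 * (j : ℂ) ^ 2 + 12 * (j : ℂ)) * t
    + (1 / 2) * (j : ℂ) * (35 * (j : ℂ) - 7) * t⁻¹
    - (1 / 2) * (j : ℂ) * (10 * (j : ℂ) - 6) * (t ^ 3)⁻¹
    + (1 / 2) * (j : ℂ) * ((j : ℂ) - 1) * (t ^ 5)⁻¹

section Values

variable {G : Type*} [Group G] {ρ : G →* GL (Fin 3) ℂ} {z : G → Fin 3 → ℂ}

/-- The element `g` acts by the upper triangular matrix with diagonal `(p, 1, r)` and entries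
`a, b, c` above it, and `z` takes the value `(z₁, z₂, z₃)` at `g`. -/
def HasValue (ρ : G →* GL (Fin 3) ℂ) (z : G → Fin 3 → ℂ) (g : G)
    (p a b c r z₁ z₂ z₃ : ℂ) : Prop :=
  (ρ g : Matrix (Fin 3) (Fin 3) ℂ) = !![p, a, b; 0, 1, c; 0, 0, r] ∧ z g = ![z₁, z₂, z₃]

theorem HasValue.congr {g : G} {p a b c r z₁ z₂ z₃ p' a' b' c' r' z₁' z₂' z₃' : ℂ}
    (hg : HasValue ρ z g p a b c r z₁ z₂ z₃) (hp : p = p') (ha : a = a') (hb : b = b')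
    (hc : c = c') (hr : r = r') (h₁ : z₁ = z₁') (h₂ : z₂ = z₂') (h₃ : z₃ = z₃') :
    HasValue ρ z g p' a' b' c' r' z₁' z₂' z₃' := by
  subst_vars
  exact hg

theorem HasValue.mul
    (hz : ∀ g h : G, z (g * h) = z g + (ρ g : Matrix (Fin 3) (Fin 3) ℂ).mulVec (z h))
    {g h : G} {p a b c r z₁ z₂ z₃ p' a' b' c' r' z₁' z₂' z₃' : ℂ}
    (hg : HasValue ρ z g p a b c r z₁ z₂ z₃) (hh : HasValue ρ z h p' a' b' c' r' z₁' z₂' z₃') :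
    HasValue ρ z (g * h) (p * p') (p * a' + a) (p * b' + a * c' + b * r') (c' + c * r') (r * r')
      (z₁ + p * z₁' + a * z₂' + b * z₃') (z₂ + z₂' + c * z₃') (z₃ + r * z₃') := by
  constructor
  · rw [map_mul, Units.val_mul, hg.1, hh.1]
    ext i k
    fin_cases i <;> fin_cases k <;> simp [Matrix.mul_apply, Fin.sum_univ_three]
  · rw [hz, hg.1, hg.2, hh.2]
    ext i
    fin_cases i <;> simp <;> ring

theorem HasValue.inv
    (hz : ∀ g h : G, z (g * h) = z g + (ρ g : Matrix (Fin 3) (Fin 3) ℂ).mulVec (z h))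
    {g : G} {p a b c r z₁ z₂ z₃ p' r' : ℂ} (hg : HasValue ρ z g p a b c r z₁ z₂ z₃)
    (hp : p * p' = 1) (hr : r * r' = 1) :
    HasValue ρ z g⁻¹ p' (-(p' * a)) (p' * r' * (a * c - b)) (-(c * r')) r'
      (-(p' * z₁ - p' * a * z₂ + p' * r' * (a * c - b) * z₃)) (-(z₂ - c * r' * z₃))
      (-(r' * z₃)) := by
  have hρ : (ρ g⁻¹ : Matrix (Fin 3) (Fin 3) ℂ) =
      !![p', -(p' * a), p' * r' * (a * c - b); 0, 1, -(c * r'); 0, 0, r'] := by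
    rw [map_inv, Matrix.coe_units_inv, hg.1]
    apply Matrix.inv_eq_right_inv
    ext i k
    fin_cases i <;> fin_cases k <;>
      simp [Matrix.mul_apply, Fin.sum_univ_three, hp, hr]
    · linear_combination -a * hp
    · linear_combination (a * c - b) * r' * hp
  refine ⟨hρ, ?_⟩
  have h1 : z 1 = 0 := by simpa using hz 1 1
  have h := hz g⁻¹ g
  rw [inv_mul_cancel, h1, hρ, hg.2] at h
  rw [← neg_eq_of_add_eq_zero_left h.symm]
  ext i
  fin_cases i <;> simp <;> ring

theorem HasValue.pow
    (hz : ∀ g h : G, z (g * h) = z g + (ρ g : Matrix (Fin 3) (Fin 3) ℂ).mulVec (z h))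
    {g : G} {a b c z₁ z₂ z₃ : ℂ} (hg : HasValue ρ z g 1 a b c 1 z₁ z₂ z₃) (n : ℕ) :
    HasValue ρ z (g ^ n) 1 (n * a) (n * b + n * (n - 1) / 2 * (a * c)) (n * c) 1
      (n * z₁ + n * (n - 1) / 2 * (a * z₂ + b * z₃) + n * (n - 1) * (n - 2) / 6 * (a * c * z₃))
      (n * z₂ + n * (n - 1) / 2 * (c * z₃)) (n * z₃) := by
  induction n with
  | zero =>
    have h1 : z 1 = 0 := by simpa using hz 1 1
    constructor
    · ext i k
      fin_cases i <;> fin_cases k <;> simp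
    · ext i
      fin_cases i <;> simp [h1]
  | succ n ih =>
    rw [pow_succ]
    refine (ih.mul hz hg).congr ?_ ?_ ?_ ?_ ?_ ?_ ?_ ?_ <;> push_cast <;> ring

/-- `z` is a 1-cocycle, and `X`, `Y` have the matrices and the cocycle values prescribed for the
generators `x`, `y`. -/
structure IsNormalized (ρ : G →* GL (Fin 3) ℂ) (z : G → Fin 3 → ℂ) (X Y : G) (t α β : ℂ) :
    Prop where
  ne_zero : t ≠ 0
  cocycle : ∀ g h : G, z (g * h) = z g + (ρ g : Matrix (Fin 3) (Fin 3) ℂ).mulVec (z h)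
  x : HasValue ρ z X (t ^ 2) 0 0 0 (t⁻¹ ^ 2) 0 α β
  y : HasValue ρ z Y (t ^ 2) (-2 * t) (-1) t⁻¹ (t⁻¹ ^ 2) 0 α 0

variable {X Y : G} {t α β : ℂ}

theorem IsNormalized.inv_x (H : IsNormalized ρ z X Y t α β) :
    HasValue ρ z (X⁻¹)
      (t⁻¹ ^ 2) 0 0 0 (t ^ 2)
      0
      (-α)
      (-t ^ 2 * β) := by
  have ht := H.ne_zero
  refine (H.x.inv H.cocycle (p' := t⁻¹ ^ 2) (r' := t ^ 2) ?_ ?_).congr ?_ ?_ ?_ ?_ ?_ ?_ ?_ ?_ <;>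
    field_simp <;> ring

theorem IsNormalized.inv_y (H : IsNormalized ρ z X Y t α β) :
    HasValue ρ z (Y⁻¹)
      (t⁻¹ ^ 2) (2 * t⁻¹) (-1) (-t) (t ^ 2)
      (-2 * t⁻¹ * α)
      (-α)
      0 := by
  have ht := H.ne_zero
  refine (H.y.inv H.cocycle (p' := t⁻¹ ^ 2) (r' := t ^ 2) ?_ ?_).congr ?_ ?_ ?_ ?_ ?_ ?_ ?_ ?_ <;>
    field_simp <;> ring

theorem IsNormalized.hasValue_y_xi_y_x (H : IsNormalized ρ z X Y t α β) :
    HasValue ρ z (Y * X⁻¹ * Y * X)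
      (t ^ 4) (-4 * t) (-4 * t⁻¹ ^ 2) (2 * t⁻¹ ^ 3) (t⁻¹ ^ 4)
      (-4 * t * α + t ^ 2 * β - 4 * β)
      (2 * α - t * β + 2 * t⁻¹ * β)
      (-β + t⁻¹ ^ 2 * β) := by
  have ht := H.ne_zero
  refine (((H.y.mul H.cocycle H.inv_x).mul H.cocycle H.y).mul H.cocycle H.x).congr
      ?_ ?_ ?_ ?_ ?_ ?_ ?_ ?_ <;>
    field_simp <;> ring

theorem IsNormalized.hasValue_yi_xi_y_xi (H : IsNormalized ρ z X Y t α β) :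
    HasValue ρ z (Y⁻¹ * X⁻¹ * Y * X⁻¹)
      (t⁻¹ ^ 4) (2 * t⁻¹ - 2 * t⁻¹ ^ 3) (-t ^ 2 + 2 - t⁻¹ ^ 2) (-t ^ 3 + t) (t ^ 4)
      (-4 * t⁻¹ * α + 2 * t⁻¹ ^ 3 * α + 2 * t ^ 2 * β - 2 * β + t⁻¹ ^ 2 * β)
      (-2 * α + 2 * t ^ 3 * β - t * β)
      (-2 * t ^ 4 * β) := by
  have ht := H.ne_zero
  refine (((H.inv_y.mul H.cocycle H.inv_x).mul H.cocycle H.y).mul H.cocycle H.inv_x).congr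
      ?_ ?_ ?_ ?_ ?_ ?_ ?_ ?_ <;>
    field_simp <;> ring

theorem IsNormalized.hasValue_yi_x_y_xi (H : IsNormalized ρ z X Y t α β) :
    HasValue ρ z (Y⁻¹ * X * Y * X⁻¹)
      1 (-2 * t + 2 * t⁻¹) (-t ^ 2 + 2 - t⁻¹ ^ 2) (t - t⁻¹) 1
      (2 * t * α + t ^ 2 * β - 3 * β + t⁻¹ ^ 2 * β)
      (-2 * t * β + t⁻¹ * β)
      (t ^ 2 * β - β) := by
  have ht := H.ne_zero
  refine (((H.inv_y.mul H.cocycle H.x).mul H.cocycle H.y).mul H.cocycle H.inv_x).congr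
      ?_ ?_ ?_ ?_ ?_ ?_ ?_ ?_ <;>
    field_simp <;> ring

theorem IsNormalized.hasValue_yi_x_yi_xi (H : IsNormalized ρ z X Y t α β) :
    HasValue ρ z (Y⁻¹ * X * Y⁻¹ * X⁻¹)
      (t⁻¹ ^ 4) (4 * t⁻¹) (-4 * t ^ 2) (-2 * t ^ 3) (t ^ 4)
      (-8 * t⁻¹ * α + 4 * t ^ 2 * β - β)
      (-2 * α + 2 * t ^ 3 * β - t * β)
      (-t ^ 4 * β + t ^ 2 * β) := by
  have ht := H.ne_zero
  refine (((H.inv_y.mul H.cocycle H.x).mul H.cocycle H.inv_y).mul H.cocycle H.inv_x).congr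
      ?_ ?_ ?_ ?_ ?_ ?_ ?_ ?_ <;>
    field_simp <;> ring

theorem IsNormalized.hasValue_y_x_yi_x (H : IsNormalized ρ z X Y t α β) :
    HasValue ρ z (Y * X * Y⁻¹ * X)
      (t ^ 4) (2 * t ^ 3 - 2 * t) (-t ^ 2 + 2 - t⁻¹ ^ 2) (-t⁻¹ + t⁻¹ ^ 3) (t⁻¹ ^ 4)
      (-2 * t * α - t ^ 4 * β + 2 * t ^ 2 * β - 2 * β)
      (2 * α - t * β + 2 * t⁻¹ * β)
      (2 * t⁻¹ ^ 2 * β) := by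
  have ht := H.ne_zero
  refine (((H.y.mul H.cocycle H.x).mul H.cocycle H.inv_y).mul H.cocycle H.x).congr
      ?_ ?_ ?_ ?_ ?_ ?_ ?_ ?_ <;>
    field_simp <;> ring

theorem IsNormalized.hasValue_y_xi_yi_x (H : IsNormalized ρ z X Y t α β) :
    HasValue ρ z (Y * X⁻¹ * Y⁻¹ * X)
      1 (-2 * t + 2 * t⁻¹) (-t ^ 2 + 2 - t⁻¹ ^ 2) (t - t⁻¹) 1
      (2 * t * α - t ^ 4 * β + 3 * t ^ 2 * β - β)
      (t ^ 3 * β - 2 * t * β)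
      (t ^ 2 * β - β) := by
  have ht := H.ne_zero
  refine (((H.y.mul H.cocycle H.inv_x).mul H.cocycle H.inv_y).mul H.cocycle H.x).congr
      ?_ ?_ ?_ ?_ ?_ ?_ ?_ ?_ <;>
    field_simp <;> ring

theorem IsNormalized.hasValue_x_yi_xi_y (H : IsNormalized ρ z X Y t α β) :
    HasValue ρ z (X * Y⁻¹ * X⁻¹ * Y)
      1 (2 * t - 2 * t⁻¹) (-t ^ 2 + 2 - t⁻¹ ^ 2) (-t + t⁻¹) 1
      (-2 * t * α + t ^ 4 * β)
      (t ^ 3 * β)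
      (-t ^ 2 * β + β) := by
  have ht := H.ne_zero
  refine (((H.x.mul H.cocycle H.inv_y).mul H.cocycle H.inv_x).mul H.cocycle H.y).congr
      ?_ ?_ ?_ ?_ ?_ ?_ ?_ ?_ <;>
    field_simp <;> ring

theorem IsNormalized.hasValue_x_yi_x_y (H : IsNormalized ρ z X Y t α β) :
    HasValue ρ z (X * Y⁻¹ * X * Y)
      (t ^ 4) (-2 * t ^ 3 + 2 * t) (-t ^ 2 + 2 - t⁻¹ ^ 2) (t⁻¹ - t⁻¹ ^ 3) (t⁻¹ ^ 4)
      (2 * t * α - t ^ 2 * β)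
      (2 * α - t * β)
      (2 * β) := by
  have ht := H.ne_zero
  refine (((H.x.mul H.cocycle H.inv_y).mul H.cocycle H.x).mul H.cocycle H.y).congr
      ?_ ?_ ?_ ?_ ?_ ?_ ?_ ?_ <;>
    field_simp <;> ring

theorem IsNormalized.hasValue_xi_yi_x_yi (H : IsNormalized ρ z X Y t α β) :
    HasValue ρ z (X⁻¹ * Y⁻¹ * X * Y⁻¹)
      (t⁻¹ ^ 4) (4 * t⁻¹ ^ 3) (-4 * t⁻¹ ^ 2) (-2 * t) (t ^ 4)
      (-4 * t⁻¹ ^ 3 * α - t⁻¹ ^ 2 * β)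
      (-2 * α - t * β)
      (t ^ 4 * β - t ^ 2 * β) := by
  have ht := H.ne_zero
  refine (((H.inv_x.mul H.cocycle H.inv_y).mul H.cocycle H.x).mul H.cocycle H.inv_y).congr
      ?_ ?_ ?_ ?_ ?_ ?_ ?_ ?_ <;>
    field_simp <;> ring

theorem IsNormalized.hasValue_xi_y_x_yi (H : IsNormalized ρ z X Y t α β) :
    HasValue ρ z (X⁻¹ * Y * X * Y⁻¹)
      1 (2 * t - 2 * t⁻¹) (-t ^ 2 + 2 - t⁻¹ ^ 2) (-t + t⁻¹) 1
      (-2 * t * α - t⁻¹ ^ 2 * β)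
      (t⁻¹ * β)
      (-t ^ 2 * β + β) := by
  have ht := H.ne_zero
  refine (((H.inv_x.mul H.cocycle H.y).mul H.cocycle H.x).mul H.cocycle H.inv_y).congr
      ?_ ?_ ?_ ?_ ?_ ?_ ?_ ?_ <;>
    field_simp <;> ring

theorem IsNormalized.hasValue_xi_y_xi_yi (H : IsNormalized ρ z X Y t α β) :
    HasValue ρ z (X⁻¹ * Y * X⁻¹ * Y⁻¹)
      (t⁻¹ ^ 4) (-2 * t⁻¹ + 2 * t⁻¹ ^ 3) (-t ^ 2 + 2 - t⁻¹ ^ 2) (t ^ 3 - t) (t ^ 4)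
      (4 * t⁻¹ * α - 2 * t⁻¹ ^ 3 * α + β)
      (-2 * α - t * β)
      (-2 * t ^ 2 * β) := by
  have ht := H.ne_zero
  refine (((H.inv_x.mul H.cocycle H.y).mul H.cocycle H.inv_x).mul H.cocycle H.inv_y).congr
      ?_ ?_ ?_ ?_ ?_ ?_ ?_ ?_ <;>
    field_simp <;> ring

theorem IsNormalized.hasValue_x_y_xi_y (H : IsNormalized ρ z X Y t α β) :
    HasValue ρ z (X * Y * X⁻¹ * Y)
      (t ^ 4) (-4 * t ^ 3) (-4 * t ^ 2) (2 * t⁻¹) (t⁻¹ ^ 4)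
      (t ^ 4 * β)
      (2 * α - t * β)
      (β - t⁻¹ ^ 2 * β) := by
  have ht := H.ne_zero
  refine (((H.x.mul H.cocycle H.y).mul H.cocycle H.inv_x).mul H.cocycle H.y).congr
      ?_ ?_ ?_ ?_ ?_ ?_ ?_ ?_ <;>
    field_simp <;> ring

/-- The matrix and the cocycle value of the word `u`. -/
theorem IsNormalized.hasValue_u (H : IsNormalized ρ z X Y t α β) :
    HasValue ρ z ((Y * X⁻¹ * Y * X) * (Y⁻¹ * X⁻¹ * Y * X⁻¹) * (Y⁻¹ * X * Y * X⁻¹) * (Y⁻¹ * X *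
      Y⁻¹ * X⁻¹) * (Y * X * Y⁻¹ * X) * (Y * X⁻¹ * Y⁻¹ * X))
      1 (2 * t ^ 3 - 10 * t + 10 * t⁻¹ - 2 * t⁻¹ ^ 3) (-t ^ 6 + 10 * t ^ 4 - 35 * t ^ 2 + 52 -
        35 * t⁻¹ ^ 2 + 10 * t⁻¹ ^ 4 - t⁻¹ ^ 6) (-t ^ 3 + 5 * t - 5 * t⁻¹ + t⁻¹ ^ 3) 1
      (-4 * t ^ 3 * α + 10 * t * α - 2 * t⁻¹ ^ 3 * α + t ^ 10 * β - 13 * t ^ 8 * β + 66 * t ^ 6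
        * β - 164 * t ^ 4 * β + 208 * t ^ 2 * β - 135 * β + 51 * t⁻¹ ^ 2 * β - 11 * t⁻¹ ^ 4 * β +
        t⁻¹ ^ 6 * β)
      (t ^ 7 * β - 9 * t ^ 5 * β + 27 * t ^ 3 * β - 30 * t * β + 10 * t⁻¹ * β - t⁻¹ ^ 3 * β)
      (-t ^ 4 * β + 5 * t ^ 2 * β - 5 * β + t⁻¹ ^ 2 * β) := by
  have ht := H.ne_zero
  have h2 : HasValue ρ z ((Y * X⁻¹ * Y * X) * (Y⁻¹ * X⁻¹ * Y * X⁻¹))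
      1 (2 * t ^ 3 - 6 * t) (-t ^ 6 + 6 * t ^ 4 - 9 * t ^ 2) (-t ^ 3 + 3 * t) 1
      (-4 * t ^ 3 * α + 6 * t * α + 2 * t ^ 6 * β - 10 * t ^ 4 * β + 14 * t ^ 2 * β - 4 * β)
      (2 * t ^ 3 * β - 6 * t * β + 2 * t⁻¹ * β)
      (-3 * β + t⁻¹ ^ 2 * β) := by
    refine (H.hasValue_y_xi_y_x.mul H.cocycle H.hasValue_yi_xi_y_xi).congr
      ?_ ?_ ?_ ?_ ?_ ?_ ?_ ?_ <;> field_simp <;> ring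
  have h3 : HasValue ρ z ((Y * X⁻¹ * Y * X) * (Y⁻¹ * X⁻¹ * Y * X⁻¹) * (Y⁻¹ * X * Y * X⁻¹))
      1 (2 * t ^ 3 - 8 * t + 2 * t⁻¹) (-t ^ 6 + 8 * t ^ 4 - 18 * t ^ 2 + 8 - t⁻¹ ^ 2) (-t ^ 3 +
        4 * t - t⁻¹) 1
      (-4 * t ^ 3 * α + 8 * t * α - t ^ 8 * β + 9 * t ^ 6 * β - 29 * t ^ 4 * β + 38 * t ^ 2 * β
        - 13 * β + t⁻¹ ^ 2 * β)
      (-t ^ 5 * β + 6 * t ^ 3 * β - 11 * t * β + 3 * t⁻¹ * β)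
      (t ^ 2 * β - 4 * β + t⁻¹ ^ 2 * β) := by
    refine (h2.mul H.cocycle H.hasValue_yi_x_y_xi).congr
      ?_ ?_ ?_ ?_ ?_ ?_ ?_ ?_ <;> field_simp <;> ring
  have h4 : HasValue ρ z ((Y * X⁻¹ * Y * X) * (Y⁻¹ * X⁻¹ * Y * X⁻¹) * (Y⁻¹ * X * Y * X⁻¹) * (Y⁻¹
    * X * Y⁻¹ * X⁻¹))
      (t⁻¹ ^ 4) (2 * t ^ 3 - 8 * t + 6 * t⁻¹) (-t ^ 10 + 8 * t ^ 8 - 22 * t ^ 6 + 24 * t ^ 4 - 9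
        * t ^ 2) (-t ^ 7 + 4 * t ^ 5 - 3 * t ^ 3) (t ^ 4)
      (-8 * t ^ 3 * α + 24 * t * α - 12 * t⁻¹ * α + t ^ 10 * β - 10 * t ^ 8 * β + 39 * t ^ 6 * β
        - 73 * t ^ 4 * β + 63 * t ^ 2 * β - 17 * β + t⁻¹ ^ 2 * β)
      (-2 * α + t ^ 7 * β - 6 * t ^ 5 * β + 13 * t ^ 3 * β - 13 * t * β + 3 * t⁻¹ * β)
      (-t ^ 4 * β + 2 * t ^ 2 * β - 4 * β + t⁻¹ ^ 2 * β) := by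
    refine (h3.mul H.cocycle H.hasValue_yi_x_yi_xi).congr
      ?_ ?_ ?_ ?_ ?_ ?_ ?_ ?_ <;> field_simp <;> ring
  have h5 : HasValue ρ z ((Y * X⁻¹ * Y * X) * (Y⁻¹ * X⁻¹ * Y * X⁻¹) * (Y⁻¹ * X * Y * X⁻¹) * (Y⁻¹
    * X * Y⁻¹ * X⁻¹) * (Y * X * Y⁻¹ * X))
      1 (2 * t ^ 3 - 8 * t + 8 * t⁻¹ - 2 * t⁻¹ ^ 3) (-t ^ 6 + 8 * t ^ 4 - 24 * t ^ 2 + 34 - 24 *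
        t⁻¹ ^ 2 + 8 * t⁻¹ ^ 4 - t⁻¹ ^ 6) (-t ^ 3 + 4 * t - 4 * t⁻¹ + t⁻¹ ^ 3) 1
      (-4 * t ^ 3 * α + 8 * t * α - 2 * t⁻¹ ^ 3 * α + t ^ 10 * β - 12 * t ^ 8 * β + 55 * t ^ 6 *
        β - 119 * t ^ 4 * β + 123 * t ^ 2 * β - 58 * β + 15 * t⁻¹ ^ 2 * β - 2 * t⁻¹ ^ 4 * β)
      (t ^ 7 * β - 8 * t ^ 5 * β + 21 * t ^ 3 * β - 20 * t * β + 5 * t⁻¹ * β)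
      (-t ^ 4 * β + 4 * t ^ 2 * β - 4 * β + t⁻¹ ^ 2 * β) := by
    refine (h4.mul H.cocycle H.hasValue_y_x_yi_x).congr
      ?_ ?_ ?_ ?_ ?_ ?_ ?_ ?_ <;> field_simp <;> ring
  refine (h5.mul H.cocycle H.hasValue_y_xi_yi_x).congr
      ?_ ?_ ?_ ?_ ?_ ?_ ?_ ?_ <;> field_simp <;> ring

/-- The matrix and the cocycle value of the word `s`. -/
theorem IsNormalized.hasValue_s (H : IsNormalized ρ z X Y t α β) :
    HasValue ρ z ((X * Y⁻¹ * X⁻¹ * Y) * (X * Y⁻¹ * X * Y) * (X⁻¹ * Y⁻¹ * X * Y⁻¹) * (X⁻¹ * Y * X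
      * Y⁻¹) * (X⁻¹ * Y * X⁻¹ * Y⁻¹) * (X * Y * X⁻¹ * Y))
      1 (-2 * t ^ 3 + 10 * t - 10 * t⁻¹ + 2 * t⁻¹ ^ 3) (-t ^ 6 + 10 * t ^ 4 - 35 * t ^ 2 + 52 -
        35 * t⁻¹ ^ 2 + 10 * t⁻¹ ^ 4 - t⁻¹ ^ 6) (t ^ 3 - 5 * t + 5 * t⁻¹ - t⁻¹ ^ 3) 1
      (4 * t ^ 3 * α - 10 * t * α + 2 * t⁻¹ ^ 3 * α - t ^ 10 * β + 14 * t ^ 8 * β - 71 * t ^ 6 *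
        β + 159 * t ^ 4 * β - 159 * t ^ 2 * β + 80 * β - 20 * t⁻¹ ^ 2 * β + 2 * t⁻¹ ^ 4 * β)
      (t ^ 7 * β - 9 * t ^ 5 * β + 25 * t ^ 3 * β - 22 * t * β + 8 * t⁻¹ * β - t⁻¹ ^ 3 * β)
      (t ^ 4 * β - 5 * t ^ 2 * β + 5 * β - t⁻¹ ^ 2 * β) := by
  have ht := H.ne_zero
  have h2 : HasValue ρ z ((X * Y⁻¹ * X⁻¹ * Y) * (X * Y⁻¹ * X * Y))
      (t ^ 4) (-2 * t ^ 3 + 4 * t - 2 * t⁻¹) (-t ^ 2 + 4 - 6 * t⁻¹ ^ 2 + 4 * t⁻¹ ^ 4 - t⁻¹ ^ 6)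
        (t⁻¹ - 2 * t⁻¹ ^ 3 + t⁻¹ ^ 5) (t⁻¹ ^ 4)
      (4 * t * α - 4 * t⁻¹ * α + t ^ 4 * β - 5 * t ^ 2 * β + 6 * β - 2 * t⁻¹ ^ 2 * β)
      (2 * α + t ^ 3 * β - 3 * t * β + 2 * t⁻¹ * β)
      (-t ^ 2 * β + 3 * β) := by
    refine (H.hasValue_x_yi_xi_y.mul H.cocycle H.hasValue_x_yi_x_y).congr
      ?_ ?_ ?_ ?_ ?_ ?_ ?_ ?_ <;> field_simp <;> ring
  have h3 : HasValue ρ z ((X * Y⁻¹ * X⁻¹ * Y) * (X * Y⁻¹ * X * Y) * (X⁻¹ * Y⁻¹ * X * Y⁻¹))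
      1 (-2 * t ^ 3 + 8 * t - 2 * t⁻¹) (-t ^ 6 + 8 * t ^ 4 - 18 * t ^ 2 + 8 - t⁻¹ ^ 2) (t ^ 3 -
        4 * t + t⁻¹) 1
      (4 * t ^ 3 * α - 8 * t * α - t ^ 6 * β + 8 * t ^ 4 * β - 20 * t ^ 2 * β + 18 * β - 7 * t⁻¹
        ^ 2 * β + t⁻¹ ^ 4 * β)
      (2 * t ^ 3 * β - 7 * t * β + 5 * t⁻¹ * β - t⁻¹ ^ 3 * β)
      (-t ^ 2 * β + 4 * β - t⁻¹ ^ 2 * β) := by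
    refine (h2.mul H.cocycle H.hasValue_xi_yi_x_yi).congr
      ?_ ?_ ?_ ?_ ?_ ?_ ?_ ?_ <;> field_simp <;> ring
  have h4 : HasValue ρ z ((X * Y⁻¹ * X⁻¹ * Y) * (X * Y⁻¹ * X * Y) * (X⁻¹ * Y⁻¹ * X * Y⁻¹) * (X⁻¹
    * Y * X * Y⁻¹))
      1 (-2 * t ^ 3 + 10 * t - 4 * t⁻¹) (-t ^ 6 + 10 * t ^ 4 - 29 * t ^ 2 + 20 - 4 * t⁻¹ ^ 2) (t
        ^ 3 - 5 * t + 2 * t⁻¹) 1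
      (4 * t ^ 3 * α - 10 * t * α + t ^ 8 * β - 10 * t ^ 6 * β + 34 * t ^ 4 * β - 48 * t ^ 2 * β
        + 35 * β - 11 * t⁻¹ ^ 2 * β + t⁻¹ ^ 4 * β)
      (-t ^ 5 * β + 7 * t ^ 3 * β - 12 * t * β + 7 * t⁻¹ * β - t⁻¹ ^ 3 * β)
      (-2 * t ^ 2 * β + 5 * β - t⁻¹ ^ 2 * β) := by
    refine (h3.mul H.cocycle H.hasValue_xi_y_x_yi).congr
      ?_ ?_ ?_ ?_ ?_ ?_ ?_ ?_ <;> field_simp <;> ring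
  have h5 : HasValue ρ z ((X * Y⁻¹ * X⁻¹ * Y) * (X * Y⁻¹ * X * Y) * (X⁻¹ * Y⁻¹ * X * Y⁻¹) * (X⁻¹
    * Y * X * Y⁻¹) * (X⁻¹ * Y * X⁻¹ * Y⁻¹))
      (t⁻¹ ^ 4) (-2 * t ^ 3 + 10 * t - 6 * t⁻¹ + 2 * t⁻¹ ^ 3) (-t ^ 10 + 10 * t ^ 8 - 31 * t ^ 6
        + 32 * t ^ 4 - 19 * t ^ 2 + 6 - t⁻¹ ^ 2) (t ^ 7 - 5 * t ^ 5 + 3 * t ^ 3 - t) (t ^ 4)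
      (8 * t ^ 3 * α - 30 * t * α + 12 * t⁻¹ * α - 2 * t⁻¹ ^ 3 * α + 3 * t ^ 8 * β - 30 * t ^ 6
        * β + 94 * t ^ 4 * β - 98 * t ^ 2 * β + 48 * β - 11 * t⁻¹ ^ 2 * β + t⁻¹ ^ 4 * β)
      (-2 * α - 3 * t ^ 5 * β + 17 * t ^ 3 * β - 17 * t * β + 7 * t⁻¹ * β - t⁻¹ ^ 3 * β)
      (-4 * t ^ 2 * β + 5 * β - t⁻¹ ^ 2 * β) := by
    refine (h4.mul H.cocycle H.hasValue_xi_y_xi_yi).congr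
      ?_ ?_ ?_ ?_ ?_ ?_ ?_ ?_ <;> field_simp <;> ring
  refine (h5.mul H.cocycle H.hasValue_x_y_xi_y).congr
      ?_ ?_ ?_ ?_ ?_ ?_ ?_ ?_ <;> field_simp <;> ring

end Values

/-- The values `z(w̄) = (ω₁, ω₂, ω₃)` and `z(v̄) = (ν₁, ν₂, ν₃)` of a normalized 1-cocycle on
the images `w̄, v̄ ∈ Γ_j(0)` of the words `w` and `v` satisfy
`ω₃ = t f β = −ν₃`, `ω₂ = C_w β`, `ν₂ = C_v β` and
`ω₁ = α(−4jt³ + (10j+2)t − 2jt⁻³) + βh` for some `h ∈ ℂ`. -/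
theorem cocycle_values_on_w_and_v (j : ℕ) (hj : 1 ≤ j) (t : ℝ)
    (ht0 : t ≠ 0) (ht1 : t ≠ 1) (ht1' : t ≠ -1)
    (hΔ : (j : ℝ) * (t ^ 2) ^ 4 - (6 * (j : ℝ) + 1) * (t ^ 2) ^ 3
      + (10 * (j : ℝ) + 3) * (t ^ 2) ^ 2 - (6 * (j : ℝ) + 1) * t ^ 2 + (j : ℝ) = 0)
    (ρ : Γ₀ j →* GL (Fin 3) ℂ)
    (hx : (ρ (PresentedGroup.of false) : Matrix (Fin 3) (Fin 3) ℂ) =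
      !![(t : ℂ) ^ 2, 0, 0; 0, 1, 0; 0, 0, ((t : ℂ) ^ 2)⁻¹])
    (hy : (ρ (PresentedGroup.of true) : Matrix (Fin 3) (Fin 3) ℂ) =
      !![(t : ℂ) ^ 2, -2 * (t : ℂ), -1; 0, 1, (t : ℂ)⁻¹; 0, 0, ((t : ℂ) ^ 2)⁻¹])
    (z : Γ₀ j → Fin 3 → ℂ) (hz : IsCocycle ρ z) (α β : ℂ)
    (hzx : z (PresentedGroup.of false) = ![0, α, β])
    (hzy : z (PresentedGroup.of true) = ![0, α, 0]) :
    z (PresentedGroup.mk (rels j) (w j)) 2 = (t : ℂ) * f j t * β ∧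
    z (PresentedGroup.mk (rels j) (v j)) 2 = -((t : ℂ) * f j t * β) ∧
    z (PresentedGroup.mk (rels j) (w j)) 1 = Cw j (t : ℂ) * β ∧
    z (PresentedGroup.mk (rels j) (v j)) 1 = Cv j (t : ℂ) * β ∧
    ∃ h : ℂ, z (PresentedGroup.mk (rels j) (w j)) 0 =
      α * (-4 * (j : ℂ) * (t : ℂ) ^ 3 + (10 * (j : ℂ) + 2) * (t : ℂ)
            - 2 * (j : ℂ) * ((t : ℂ) ^ 3)⁻¹) + β * h := by
  have ht : (t : ℂ) ≠ 0 := by exact_mod_cast ht0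
  have H : IsNormalized ρ z (PresentedGroup.of false) (PresentedGroup.of true) (t : ℂ) α β :=
    ⟨ht, hz, ⟨by rw [hx, inv_pow], hzx⟩, ⟨by rw [hy, inv_pow], hzy⟩⟩
  have hw := H.hasValue_y_xi_yi_x.mul hz (H.hasValue_u.pow hz j)
  have hv := (H.hasValue_s.pow hz j).mul hz H.hasValue_x_yi_xi_y
  have hwz : z (PresentedGroup.mk (rels j) (w j)) = _ := hw.2
  have hvz : z (PresentedGroup.mk (rels j) (v j)) = _ := hv.2
  rw [hwz, hvz]
  simp only [Matrix.cons_val, f, Cw, Cv]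
  refine ⟨?_, ?_, ?_, ?_, ?_⟩
  · field_simp
    ring
  · field_simp
    ring
  · field_simp
    ring
  · field_simp
    ring
  · refine ⟨(-(t : ℂ) ^ 4 + 3 * (t : ℂ) ^ 2 - 1)
      + (j : ℂ) * ((t : ℂ) ^ 10 - 15 * (t : ℂ) ^ 8 + 87 * (t : ℂ) ^ 6 - 243 * (t : ℂ) ^ 4 + 338
        * (t : ℂ) ^ 2 - 231 + 80 * (t : ℂ)⁻¹ ^ 2 - 14 * (t : ℂ)⁻¹ ^ 4 + (t : ℂ)⁻¹ ^ 6)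
      + (j : ℂ) * (j - 1) / 2 * (3 * (t : ℂ) ^ 10 - 45 * (t : ℂ) ^ 8 + 266 * (t : ℂ) ^ 6 - 790 *
        (t : ℂ) ^ 4 + 1262 * (t : ℂ) ^ 2 - 1110 + 538 * (t : ℂ)⁻¹ ^ 2 - 142 * (t : ℂ)⁻¹ ^ 4 + 19 *
        (t : ℂ)⁻¹ ^ 6 - (t : ℂ)⁻¹ ^ 8)
      + (j : ℂ) * (j - 1) * (j - 2) / 6 * (2 * (t : ℂ) ^ 10 - 30 * (t : ℂ) ^ 8 + 180 * (t : ℂ) ^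
        6 - 556 * (t : ℂ) ^ 4 + 960 * (t : ℂ) ^ 2 - 960 + 556 * (t : ℂ)⁻¹ ^ 2 - 180 * (t : ℂ)⁻¹ ^
        4 + 30 * (t : ℂ)⁻¹ ^ 6 - 2 * (t : ℂ)⁻¹ ^ 8), ?_⟩
    field_simp
    ring

end Stmt15
end

section
/- Let j ≥ 1 be an integer, let t ∈ ℝ with t ∉ {0, 1, −1} and Δ_j(t²) = 0, and let ρ : Γ_j(0) → GL₃(ℂ) be any group homomorphism with ρ(x) = [[t², 0, 0], [0, 1, 0], [0, 0, t⁻²]] and ρ(y) = [[t², −2t, −1], [0, 1, t⁻¹], [0, 0, t⁻²]]. Then H¹(Γ_j(0); ℂ³_ρ) = 0; that is, every 1-cocycle z : Γ_j(0) → ℂ³ is a 1-coboundary. -/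
namespace Stmt16

open Matrix

/-- The generator `x` of the free group on two letters. -/
def x : FreeGroup Bool := FreeGroup.of false

/-- The generator `y` of the free group on two letters. -/
def y : FreeGroup Bool := FreeGroup.of true

/-- The word `u` from the paper. -/
def u : FreeGroup Bool :=
  (y * x⁻¹ * y * x) * (y⁻¹ * x⁻¹ * y * x⁻¹) * (y⁻¹ * x * y * x⁻¹) *
  (y⁻¹ * x * y⁻¹ * x⁻¹) * (y * x * y⁻¹ * x) * (y * x⁻¹ * y⁻¹ * x)

/-- The word `s`, which is `u` spelled backwards (the 24 letters of `u` in reverse order). -/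
def s : FreeGroup Bool :=
  (x * y⁻¹ * x⁻¹ * y) * (x * y⁻¹ * x * y) * (x⁻¹ * y⁻¹ * x * y⁻¹) *
  (x⁻¹ * y * x * y⁻¹) * (x⁻¹ * y * x⁻¹ * y⁻¹) * (x * y * x⁻¹ * y)

/-- The word `w = (y x⁻¹ y⁻¹ x) uʲ`. -/
def w (j : ℕ) : FreeGroup Bool := (y * x⁻¹ * y⁻¹ * x) * u ^ j

/-- The word `v = sʲ (x y⁻¹ x⁻¹ y)`. -/
def v (j : ℕ) : FreeGroup Bool := s ^ j * (x * y⁻¹ * x⁻¹ * y)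

/-- The relations `x w = w y` and `w v = 1` of `Γ_j(0) = ⟨x, y ∣ x w = w y, w v = 1⟩`. -/
def rels (j : ℕ) : Set (FreeGroup Bool) := {(x * w j) * (w j * y)⁻¹, w j * v j}

/-- The group `Γ_j(0) = ⟨x, y ∣ x w = w y, w v = 1⟩` of the `0`-filling. -/
abbrev Γ₀ (j : ℕ) := PresentedGroup (rels j)

/-- `z : Γ_j(0) → ℂ³` is a 1-cocycle for the action given by `ρ` when
`z(gh) = z(g) + ρ(g)·z(h)` for all `g, h`. -/
def IsCocycle {j : ℕ} (ρ : Γ₀ j →* GL (Fin 3) ℂ) (z : Γ₀ j → Fin 3 → ℂ) : Prop :=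
  ∀ g h : Γ₀ j, z (g * h) = z g + (ρ g : Matrix (Fin 3) (Fin 3) ℂ).mulVec (z h)

end Stmt16

namespace Stmt16

open Matrix

section UpperTriangular

variable {K : Type*} [Field K]

/-- The matrix of an affine transformation of the plane with upper triangular linear part. -/
def affineTri (a b c d e : K) : Matrix (Fin 3) (Fin 3) K :=
  !![a, b, c; 0, d, e; 0, 0, 1]

lemma affineTri_mul (a b c d e a' b' c' d' e' : K) :
    affineTri a b c d e * affineTri a' b' c' d' e' =
      affineTri (a * a') (a * b' + b * d') (a * c' + b * e' + c) (d * d') (d * e' + e) := by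
  simp [affineTri, add_assoc]

lemma affineTri_one : affineTri 1 0 0 1 0 = (1 : Matrix (Fin 3) (Fin 3) K) := by
  simp [affineTri, Matrix.one_fin_three]

lemma affineTri_translation_eq {a b c d e a' b' c' d' e' : K}
    (h : affineTri a b c d e = affineTri a' b' c' d' e') : c = c' ∧ e = e' :=
  ⟨by simpa [affineTri] using congrFun (congrFun h 0) 2,
    by simpa [affineTri] using congrFun (congrFun h 1) 2⟩

lemma affineTri_unipotent_pow [CharZero K] (b c e : K) (n : ℕ) :
    affineTri 1 b c 1 e ^ n =
      affineTri 1 (n * b) (n * c + n * (n - 1) / 2 * (b * e)) 1 (n * e) := by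
  induction n with
  | zero => simp [affineTri_one]
  | succ n ih =>
    rw [pow_succ, ih, affineTri_mul]
    push_cast
    congr 1 <;> ring

lemma map_inv_eq_affineTri {G : Type*} [Group G] (φ : G →* Matrix (Fin 3) (Fin 3) K) {g : G}
    {a b c d e : K} (ha : a ≠ 0) (hd : d ≠ 0) (hg : φ g = affineTri a b c d e) :
    φ g⁻¹ = affineTri a⁻¹ (-(a⁻¹ * b * d⁻¹)) (a⁻¹ * (b * d⁻¹ * e - c)) d⁻¹ (-(d⁻¹ * e)) := by
  refine left_inv_eq_right_inv (a := φ g) (by rw [← map_mul]; simp) ?_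
  rw [hg, affineTri_mul, ← affineTri_one]
  congr 1 <;> field_simp <;> ring

lemma mulVec_upperTri (a b c d e f p q r : K) :
    !![a, b, c; 0, d, e; 0, 0, f] *ᵥ ![p, q, r] =
      ![a * p + b * q + c * r, d * q + e * r, f * r] := by
  ext i
  fin_cases i <;> simp [-mulVec_cons, add_assoc]

end UpperTriangular

section Words

variable {K : Type*} [Field K] [CharZero K] (φ : FreeGroup Bool →* Matrix (Fin 3) (Fin 3) K)

lemma map_u_quotient {X a b c d : K} (hX : X ≠ 0)
    (hx : φ x = affineTri 1 0 b X⁻¹ 0) (hy : φ y = affineTri 1 c a X⁻¹ d) :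
    φ u = affineTri 1 (c * (X⁻¹ - 5 + 5 * X - X ^ 2))
      (c * d * (X⁻¹ - 9 + 26 * X - 26 * X ^ 2 + 9 * X ^ 3 - X ^ 4)) 1
      (-(d * (X⁻¹ - 5 + 5 * X - X ^ 2))) := by
  have hx' := map_inv_eq_affineTri φ one_ne_zero (inv_ne_zero hX) hx
  have hy' := map_inv_eq_affineTri φ one_ne_zero (inv_ne_zero hX) hy
  simp only [u, map_mul, hx, hy, hx', hy', affineTri_mul, mul_zero, zero_mul, add_zero, zero_add,
    mul_one, one_mul, inv_one, inv_inv, neg_zero, zero_sub]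
  congr 1 <;> field_simp <;> ring

lemma map_s_quotient {X a b c d : K} (hX : X ≠ 0)
    (hx : φ x = affineTri 1 0 b X⁻¹ 0) (hy : φ y = affineTri 1 c a X⁻¹ d) :
    φ s = affineTri 1 (-(c * (X⁻¹ - 5 + 5 * X - X ^ 2)))
      (c * d * (X⁻¹ - 9 + 26 * X - 26 * X ^ 2 + 9 * X ^ 3 - X ^ 4)) 1
      (d * (X⁻¹ - 5 + 5 * X - X ^ 2)) := by
  have hx' := map_inv_eq_affineTri φ one_ne_zero (inv_ne_zero hX) hx
  have hy' := map_inv_eq_affineTri φ one_ne_zero (inv_ne_zero hX) hy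
  simp only [s, map_mul, hx, hy, hx', hy', affineTri_mul, mul_zero, zero_mul, add_zero, zero_add,
    mul_one, one_mul, inv_one, inv_inv, neg_zero, zero_sub]
  congr 1 <;> field_simp <;> ring

lemma map_u_sub {X Q a b : K} (hX : X ≠ 0)
    (hx : φ x = affineTri X 0 0 1 b) (hy : φ y = affineTri X Q a 1 b) :
    φ u = affineTri 1 (Q * (X⁻¹ ^ 2 - 5 * X⁻¹ + 5 - X))
      (a * (X⁻¹ ^ 2 - 5 * X⁻¹ + 5 - X) + Q * b * (X⁻¹ ^ 2 - 5 + 2 * X)) 1 0 := by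
  have hx' := map_inv_eq_affineTri φ hX one_ne_zero hx
  have hy' := map_inv_eq_affineTri φ hX one_ne_zero hy
  simp only [u, map_mul, hx, hy, hx', hy', affineTri_mul, mul_zero, zero_mul, zero_add,
    mul_one, one_mul, inv_one, neg_zero, zero_sub]
  congr 1 <;> field_simp <;> ring

lemma relations_quotient {j : ℕ} {X a b c d : K} (hX : X ≠ 0)
    (hx : φ x = affineTri 1 0 b X⁻¹ 0) (hy : φ y = affineTri 1 c a X⁻¹ d)
    (hxw : φ (x * w j) = φ (w j * y)) (hwv : φ (w j * v j) = 1) :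
    b - a + c * d * (1 - X + j * (-X⁻¹ + 5 - 5 * X + X ^ 2)) = 0 ∧
      c * d * (1 - X ^ 2 + j * (X⁻¹ ^ 2 - 8 * X⁻¹ + 17 - 17 * X ^ 2 + 8 * X ^ 3 - X ^ 4)) = 0 := by
  have hx' := map_inv_eq_affineTri φ one_ne_zero (inv_ne_zero hX) hx
  have hy' := map_inv_eq_affineTri φ one_ne_zero (inv_ne_zero hX) hy
  have hu := map_u_quotient φ hX hx hy
  have hs := map_s_quotient φ hX hx hy
  rw [← affineTri_one] at hwv
  simp only [w, v, map_mul, map_pow, hx, hy, hx', hy', hu, hs, affineTri_unipotent_pow,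
    affineTri_mul] at hxw hwv
  obtain ⟨hxw, -⟩ := affineTri_translation_eq hxw
  obtain ⟨hwv, -⟩ := affineTri_translation_eq hwv
  refine ⟨Eq.trans ?_ (sub_eq_zero.mpr hxw), Eq.trans ?_ hwv⟩ <;> field_simp <;> ring

lemma relation_sub {j : ℕ} {X Q a b : K} (hX : X ≠ 0)
    (hx : φ x = affineTri X 0 0 1 b) (hy : φ y = affineTri X Q a 1 b)
    (hxw : φ (x * w j) = φ (w j * y)) :
    a * (X⁻¹ - 3 + X - j * (X⁻¹ ^ 2 - 6 * X⁻¹ + 10 - 6 * X + X ^ 2)) +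
      Q * b * (X⁻¹ - X - 2 * j * (X⁻¹ ^ 2 - 3 * X⁻¹ + 3 * X - X ^ 2)) = 0 := by
  have hx' := map_inv_eq_affineTri φ hX one_ne_zero hx
  have hy' := map_inv_eq_affineTri φ hX one_ne_zero hy
  have hu := map_u_sub φ hX hx hy
  simp only [w, map_mul, map_pow, hx, hy, hx', hy', hu, affineTri_unipotent_pow,
    affineTri_mul] at hxw
  obtain ⟨hxw, -⟩ := affineTri_translation_eq hxw
  refine Eq.trans ?_ (sub_eq_zero.mpr hxw)
  field_simp
  ring

end Words

section Nonvanishing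

lemma quotient_coefficient_ne_zero {J X : ℝ} (hJ : 0 < J) (hX : 0 < X) (hX1 : X ≠ 1) :
    1 - X ^ 2 + J * (X⁻¹ ^ 2 - 8 * X⁻¹ + 17 - 17 * X ^ 2 + 8 * X ^ 3 - X ^ 4) ≠ 0 := by
  have hfactor : 1 - X ^ 2 + J * (X⁻¹ ^ 2 - 8 * X⁻¹ + 17 - 17 * X ^ 2 + 8 * X ^ 3 - X ^ 4) =
      (1 - X) * (1 + X) * (1 + J * ((X ^ 2 - 4 * X + 1) / X) ^ 2) := by
    field_simp
    ring
  rw [hfactor]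
  have : 1 - X ≠ 0 := sub_ne_zero.mpr hX1.symm
  positivity

lemma sub_coefficient_ne_zero {J X : ℝ} (hX : 0 < X) (hX1 : X ≠ 1)
    (hΔ : J * X ^ 4 - (6 * J + 1) * X ^ 3 + (10 * J + 3) * X ^ 2 - (6 * J + 1) * X + J = 0) :
    X⁻¹ - X - 2 * J * (X⁻¹ ^ 2 - 3 * X⁻¹ + 3 * X - X ^ 2) ≠ 0 := by
  have hfactor : X⁻¹ - X - 2 * J * (X⁻¹ ^ 2 - 3 * X⁻¹ + 3 * X - X ^ 2) =
      (1 - X) * (1 + X) * (X - 2 * J * (X ^ 2 - 3 * X + 1)) / X ^ 2 := by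
    field_simp
    ring
  have h1 : 1 - X ≠ 0 := sub_ne_zero.mpr hX1.symm
  rw [hfactor]
  refine div_ne_zero (mul_ne_zero (by positivity) fun h => ?_) (by positivity)
  have hm : X * (X ^ 2 - 3 * X + 1 + 2 * J * X) = 0 := by
    linear_combination (-2) * hΔ - (X ^ 2 - 3 * X + 1) * h
  have hm := (mul_eq_zero.mp hm).resolve_left hX.ne'
  have : X * (1 + 4 * J ^ 2) = 0 := by linear_combination h + 2 * J * hm
  have : 0 < X * (1 + 4 * J ^ 2) := by positivity
  linarith

end Nonvanishing

section Cocycles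

variable {j : ℕ} {ρ : Γ₀ j →* GL (Fin 3) ℂ} {z : Γ₀ j → Fin 3 → ℂ}

lemma mk_x_mul_w : PresentedGroup.mk (rels j) (x * w j) = PresentedGroup.mk (rels j) (w j * y) :=
  PresentedGroup.mk_eq_mk_of_mul_inv_mem (Or.inl rfl)

lemma mk_w_mul_v : PresentedGroup.mk (rels j) (w j * v j) = 1 :=
  PresentedGroup.one_of_mem (Or.inr rfl)

lemma generators_induction {P : Γ₀ j → Prop} (hx : P (PresentedGroup.of false))
    (hy : P (PresentedGroup.of true)) (one : P 1) (mul : ∀ g h, P g → P h → P (g * h))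
    (inv : ∀ g, P g → P g⁻¹) (g : Γ₀ j) : P g := by
  have hg : g ∈ Subgroup.closure (Set.range (PresentedGroup.of (rels := rels j))) := by
    rw [PresentedGroup.closure_range_of]
    trivial
  induction hg using Subgroup.closure_induction with
  | mem _ h =>
    obtain ⟨i, rfl⟩ := h
    cases i <;> assumption
  | one => exact one
  | mul g h _ _ hg hh => exact mul g h hg hh
  | inv g _ hg => exact inv g hg

lemma IsCocycle.map_one (hz : IsCocycle ρ z) : z 1 = 0 := by
  simpa using hz 1 1

lemma IsCocycle.map_inv (hz : IsCocycle ρ z) (g : Γ₀ j) :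
    z g⁻¹ = -(ρ g⁻¹ : Matrix (Fin 3) (Fin 3) ℂ).mulVec (z g) := by
  have h := hz g⁻¹ g
  rw [inv_mul_cancel, hz.map_one] at h
  exact eq_neg_of_add_eq_zero_left h.symm

lemma IsCocycle.sub_coboundary (hz : IsCocycle ρ z) (v₀ : Fin 3 → ℂ) :
    IsCocycle ρ fun g => z g - ((ρ g : Matrix (Fin 3) (Fin 3) ℂ).mulVec v₀ - v₀) := by
  intro g h
  simp only [hz g h, map_mul, Units.val_mul, mulVec_sub, ← mulVec_mulVec]
  abel

lemma IsCocycle.eq_zero (hz : IsCocycle ρ z) (hx : z (PresentedGroup.of false) = 0)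
    (hy : z (PresentedGroup.of true) = 0) (g : Γ₀ j) : z g = 0 := by
  induction g using generators_induction with
  | hx => exact hx
  | hy => exact hy
  | one => exact hz.map_one
  | mul g h hg hh => simp [hz g h, hg, hh]
  | inv g hg => simp [hz.map_inv, hg]

lemma blockTriangular_of_generators
    (hx : (ρ (PresentedGroup.of false) : Matrix (Fin 3) (Fin 3) ℂ).BlockTriangular id)
    (hy : (ρ (PresentedGroup.of true) : Matrix (Fin 3) (Fin 3) ℂ).BlockTriangular id) (g : Γ₀ j) :
    (ρ g : Matrix (Fin 3) (Fin 3) ℂ).BlockTriangular id := by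
  induction g using generators_induction with
  | hx => exact hx
  | hy => exact hy
  | one => simpa using blockTriangular_one
  | mul g h hg hh => simpa using hg.mul hh
  | inv g hg =>
    have := (ρ g).invertible
    rw [_root_.map_inv, coe_units_inv]
    exact blockTriangular_inv_of_blockTriangular hg

lemma IsCocycle.apply_two_eq_zero (hz : IsCocycle ρ z)
    (hρ : ∀ g, (ρ g : Matrix (Fin 3) (Fin 3) ℂ).BlockTriangular id)
    (hx : z (PresentedGroup.of false) 2 = 0) (hy : z (PresentedGroup.of true) 2 = 0) (g : Γ₀ j) :
    z g 2 = 0 := by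
  have h0 (g) : (ρ g : Matrix (Fin 3) (Fin 3) ℂ) 2 0 = 0 := hρ g (by decide)
  have h1 (g) : (ρ g : Matrix (Fin 3) (Fin 3) ℂ) 2 1 = 0 := hρ g (by decide)
  induction g using generators_induction with
  | hx => exact hx
  | hy => exact hy
  | one => simp [hz.map_one]
  | mul g h hg hh => simp [hz g h, hg, hh, mulVec, dotProduct, Fin.sum_univ_three, h0, h1]
  | inv g hg =>
    simp only [hz.map_inv, Pi.neg_apply, mulVec, dotProduct, Fin.sum_univ_three, h0, h1, hg]
    simp

/-- The affine action on the quotient of `ℂ³` by the first coordinate line. -/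
noncomputable def quotientHom (hz : IsCocycle ρ z)
    (hρ : ∀ g, (ρ g : Matrix (Fin 3) (Fin 3) ℂ).BlockTriangular id) :
    Γ₀ j →* Matrix (Fin 3) (Fin 3) ℂ where
  toFun g := affineTri ((ρ g : Matrix (Fin 3) (Fin 3) ℂ) 1 1)
    ((ρ g : Matrix (Fin 3) (Fin 3) ℂ) 1 2) (z g 1) ((ρ g : Matrix (Fin 3) (Fin 3) ℂ) 2 2) (z g 2)
  map_one' := by simp [hz.map_one, affineTri_one]
  map_mul' g h := by
    have h10 : (ρ g : Matrix (Fin 3) (Fin 3) ℂ) 1 0 = 0 := hρ g (by decide)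
    have h20 : (ρ g : Matrix (Fin 3) (Fin 3) ℂ) 2 0 = 0 := hρ g (by decide)
    have h21 : (ρ g : Matrix (Fin 3) (Fin 3) ℂ) 2 1 = 0 := hρ g (by decide)
    have h21' : (ρ h : Matrix (Fin 3) (Fin 3) ℂ) 2 1 = 0 := hρ h (by decide)
    rw [affineTri_mul, hz g h]
    simp only [map_mul, Units.val_mul, Matrix.mul_apply, Pi.add_apply, mulVec, dotProduct,
      Fin.sum_univ_three, h10, h20, h21, h21']
    congr 1 <;> ring

/-- The affine action on the plane of the first two coordinates, for a cocycle with values in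
that plane. -/
noncomputable def planeHom (hz : IsCocycle ρ z)
    (hρ : ∀ g, (ρ g : Matrix (Fin 3) (Fin 3) ℂ).BlockTriangular id) (hz2 : ∀ g, z g 2 = 0) :
    Γ₀ j →* Matrix (Fin 3) (Fin 3) ℂ where
  toFun g := affineTri ((ρ g : Matrix (Fin 3) (Fin 3) ℂ) 0 0)
    ((ρ g : Matrix (Fin 3) (Fin 3) ℂ) 0 1) (z g 0) ((ρ g : Matrix (Fin 3) (Fin 3) ℂ) 1 1) (z g 1)
  map_one' := by simp [hz.map_one, affineTri_one]
  map_mul' g h := by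
    have h10 : (ρ g : Matrix (Fin 3) (Fin 3) ℂ) 1 0 = 0 := hρ g (by decide)
    have h10' : (ρ h : Matrix (Fin 3) (Fin 3) ℂ) 1 0 = 0 := hρ h (by decide)
    have h20' : (ρ h : Matrix (Fin 3) (Fin 3) ℂ) 2 0 = 0 := hρ h (by decide)
    have h21' : (ρ h : Matrix (Fin 3) (Fin 3) ℂ) 2 1 = 0 := hρ h (by decide)
    rw [affineTri_mul, hz g h]
    simp only [map_mul, Units.val_mul, Matrix.mul_apply, Pi.add_apply, mulVec, dotProduct,
      Fin.sum_univ_three, h10, h10', h20', h21', hz2 h]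
    congr 1 <;> ring

/-- A cocycle whose value at `x` lies on the second coordinate line (the fixed line of `ρ x`)
vanishes at `x`, and its value at `y` lies on the first coordinate line. -/
lemma IsCocycle.normalized (hj : 1 ≤ j) {t : ℝ} (ht0 : t ≠ 0) (ht : t ^ 2 ≠ 1)
    (hΔ : (j : ℝ) * (t ^ 2) ^ 4 - (6 * (j : ℝ) + 1) * (t ^ 2) ^ 3
      + (10 * (j : ℝ) + 3) * (t ^ 2) ^ 2 - (6 * (j : ℝ) + 1) * t ^ 2 + (j : ℝ) = 0)
    (hx : (ρ (PresentedGroup.of false) : Matrix (Fin 3) (Fin 3) ℂ) =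
      !![(t : ℂ) ^ 2, 0, 0; 0, 1, 0; 0, 0, ((t : ℂ) ^ 2)⁻¹])
    (hy : (ρ (PresentedGroup.of true) : Matrix (Fin 3) (Fin 3) ℂ) =
      !![(t : ℂ) ^ 2, -2 * (t : ℂ), -1; 0, 1, (t : ℂ)⁻¹; 0, 0, ((t : ℂ) ^ 2)⁻¹])
    (hz : IsCocycle ρ z) (hz0 : z (PresentedGroup.of false) 0 = 0)
    (hz2 : z (PresentedGroup.of false) 2 = 0) :
    z (PresentedGroup.of false) 1 = 0 ∧ z (PresentedGroup.of true) 1 = 0 ∧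
      z (PresentedGroup.of true) 2 = 0 := by
  have htC : (t : ℂ) ≠ 0 := by exact_mod_cast ht0
  have hXpos : 0 < t ^ 2 := by positivity
  have hX : (t : ℂ) ^ 2 ≠ 0 := pow_ne_zero 2 htC
  have hρ := blockTriangular_of_generators (ρ := ρ)
    (by rw [hx]; intro i k hik; fin_cases i <;> fin_cases k <;> simp_all)
    (by rw [hy]; intro i k hik; fin_cases i <;> fin_cases k <;> simp_all)
  have hqx : quotientHom hz hρ (PresentedGroup.of false) =
      affineTri 1 0 (z (PresentedGroup.of false) 1) ((t : ℂ) ^ 2)⁻¹ 0 := by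
    simp [quotientHom, hx, hz2]
  have hqy : quotientHom hz hρ (PresentedGroup.of true) =
      affineTri 1 (t : ℂ)⁻¹ (z (PresentedGroup.of true) 1) ((t : ℂ) ^ 2)⁻¹
        (z (PresentedGroup.of true) 2) := by
    simp [quotientHom, hy]
  obtain ⟨hab, hd⟩ := relations_quotient
    ((quotientHom hz hρ).comp (PresentedGroup.mk (rels j))) hX hqx hqy
    (congrArg (quotientHom hz hρ) mk_x_mul_w)
    ((congrArg (quotientHom hz hρ) mk_w_mul_v).trans (_root_.map_one _))
  have hcoeff := quotient_coefficient_ne_zero (J := j) (by exact_mod_cast hj) hXpos ht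
  replace hd : z (PresentedGroup.of true) 2 = 0 :=
    (mul_eq_zero.mp ((mul_eq_zero.mp hd).resolve_right (by exact_mod_cast hcoeff))).resolve_left
      (inv_ne_zero htC)
  rw [hd, mul_zero, zero_mul, add_zero, sub_eq_zero] at hab
  have hz2' := hz.apply_two_eq_zero hρ hz2 hd
  have hpx : planeHom hz hρ hz2' (PresentedGroup.of false) =
      affineTri ((t : ℂ) ^ 2) 0 0 1 (z (PresentedGroup.of false) 1) := by
    simp [planeHom, hx, hz0]
  have hpy : planeHom hz hρ hz2' (PresentedGroup.of true) =
      affineTri ((t : ℂ) ^ 2) (-2 * t) (z (PresentedGroup.of true) 0) 1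
        (z (PresentedGroup.of false) 1) := by
    simp [planeHom, hy, hab]
  have hb := relation_sub ((planeHom hz hρ hz2').comp (PresentedGroup.mk (rels j))) hX hpx hpy
    (congrArg (planeHom hz hρ hz2') mk_x_mul_w)
  have hΔ' : ((t : ℂ) ^ 2)⁻¹ - 3 + (t : ℂ) ^ 2 - j * (((t : ℂ) ^ 2)⁻¹ ^ 2 - 6 * ((t : ℂ) ^ 2)⁻¹
      + 10 - 6 * (t : ℂ) ^ 2 + ((t : ℂ) ^ 2) ^ 2) = 0 := by
    have hΔC : (j : ℂ) * ((t : ℂ) ^ 2) ^ 4 - (6 * (j : ℂ) + 1) * ((t : ℂ) ^ 2) ^ 3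
      + (10 * (j : ℂ) + 3) * ((t : ℂ) ^ 2) ^ 2 - (6 * (j : ℂ) + 1) * (t : ℂ) ^ 2 + (j : ℂ) = 0 := by
      exact_mod_cast hΔ
    field_simp
    linear_combination -hΔC
  have hcoeff' := sub_coefficient_ne_zero hXpos ht hΔ
  rw [hΔ', mul_zero, zero_add] at hb
  replace hb : z (PresentedGroup.of false) 1 = 0 :=
    (mul_eq_zero.mp ((mul_eq_zero.mp hb).resolve_right (by exact_mod_cast hcoeff'))).resolve_left
      (mul_ne_zero (by norm_num) htC)
  exact ⟨hb, hab ▸ hb, hd⟩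

end Cocycles

/-- `H¹(Γ_j(0); ℂ³_ρ) = 0`: every 1-cocycle for `ρ` is a 1-coboundary.  This says that the
two-bridge knot `[1,1,2,2,2j]` is locally longitudinally rigid at every root of its
Alexander polynomial. -/
theorem locally_longitudinally_rigid (j : ℕ) (hj : 1 ≤ j) (t : ℝ)
    (ht0 : t ≠ 0) (ht1 : t ≠ 1) (ht1' : t ≠ -1)
    (hΔ : (j : ℝ) * (t ^ 2) ^ 4 - (6 * (j : ℝ) + 1) * (t ^ 2) ^ 3
      + (10 * (j : ℝ) + 3) * (t ^ 2) ^ 2 - (6 * (j : ℝ) + 1) * t ^ 2 + (j : ℝ) = 0)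
    (ρ : Γ₀ j →* GL (Fin 3) ℂ)
    (hx : (ρ (PresentedGroup.of false) : Matrix (Fin 3) (Fin 3) ℂ) =
      !![(t : ℂ) ^ 2, 0, 0; 0, 1, 0; 0, 0, ((t : ℂ) ^ 2)⁻¹])
    (hy : (ρ (PresentedGroup.of true) : Matrix (Fin 3) (Fin 3) ℂ) =
      !![(t : ℂ) ^ 2, -2 * (t : ℂ), -1; 0, 1, (t : ℂ)⁻¹; 0, 0, ((t : ℂ) ^ 2)⁻¹])
    (z : Γ₀ j → Fin 3 → ℂ) (hz : IsCocycle ρ z) :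
    ∃ v₀ : Fin 3 → ℂ, ∀ g : Γ₀ j,
      z g = (ρ g : Matrix (Fin 3) (Fin 3) ℂ).mulVec v₀ - v₀ := by
  have htC : (t : ℂ) ≠ 0 := by exact_mod_cast ht0
  have ht : t ^ 2 ≠ 1 := by
    rw [Ne, sq_eq_one_iff]
    exact not_or.mpr ⟨ht1, ht1'⟩
  have hX1 : (t : ℂ) ^ 2 - 1 ≠ 0 := sub_ne_zero.mpr (by exact_mod_cast ht)
  have hX1' : ((t : ℂ) ^ 2)⁻¹ - 1 ≠ 0 := sub_ne_zero.mpr (by simpa using sub_ne_zero.mp hX1)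
  set v₁ : Fin 3 → ℂ := ![z (PresentedGroup.of false) 0 / ((t : ℂ) ^ 2 - 1), 0,
    z (PresentedGroup.of false) 2 / (((t : ℂ) ^ 2)⁻¹ - 1)] with hv₁
  set z₁ : Γ₀ j → Fin 3 → ℂ :=
    fun g => z g - ((ρ g : Matrix (Fin 3) (Fin 3) ℂ).mulVec v₁ - v₁) with hz₁
  have hcocycle : IsCocycle ρ z₁ := hz.sub_coboundary v₁
  have hx0 : z₁ (PresentedGroup.of false) 0 = 0 := by
    simp only [hz₁, hv₁, hx, mulVec_upperTri, Pi.sub_apply, cons_val]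
    field_simp
    ring
  have hx2 : z₁ (PresentedGroup.of false) 2 = 0 := by
    have := div_mul_cancel₀ (z (PresentedGroup.of false) 2) hX1'
    simp only [hz₁, hv₁, hx, mulVec_upperTri, Pi.sub_apply, cons_val]
    linear_combination -this
  obtain ⟨hx1, hy1, hy2⟩ := hcocycle.normalized hj ht0 ht hΔ hx hy hx0 hx2
  set v₂ : Fin 3 → ℂ := ![0, -(z₁ (PresentedGroup.of true) 0 / (2 * t)), 0] with hv₂
  have hzero := (hcocycle.sub_coboundary v₂).eq_zero
    (by ext i; fin_cases i <;> simp [hv₂, hx, hx0, hx1, hx2, -mulVec_cons])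
    (by ext i; fin_cases i <;> simp [hv₂, hy, hy1, hy2, -mulVec_cons]; field_simp; ring)
  refine ⟨v₁ + v₂, fun g => ?_⟩
  have hg := hzero g
  simp only [hz₁] at hg
  rw [mulVec_add]
  linear_combination hg

end Stmt16
end
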